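/- arXiv:1111.3548 — 7 statements merged into one kernel-verified Lean document; each statement's English description precedes it below -/
import Mathlib

section
/- Let r be a normal round representation on ZMod n such that the complement of 𝒢(r) is bipartite. Then for every connected component C of the complement of 𝒢(r) there exist sets 𝒳 and 𝒴 of points, each either empty or a cyclic range, such that 𝒳 ∪ 𝒴 is the vertex set of C, 𝒳 ∩ 𝒴 = ∅, 𝒴 = N̄(𝒳) (taken in 𝒢(r)), and both 𝒳 and 𝒴 are cliques of 𝒢(r). -/
open Classical

noncomputable section

def IsRoundRep (n : ℕ) (r : ZMod n → ℕ) : Prop :=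
  (∀ i, r i < n) ∧ (∀ i, r i ≤ r (i + 1) + 1)

def Arrow {n : ℕ} (r : ZMod n → ℕ) (i j : ZMod n) : Prop :=
  ∃ k : ℕ, 1 ≤ k ∧ k ≤ r i ∧ j = i + (k : ZMod n)

def Fr {n : ℕ} (r : ZMod n → ℕ) (i : ZMod n) : ZMod n := i + (r i : ZMod n)

def Fl {n : ℕ} (r : ZMod n → ℕ) (i : ZMod n) : ZMod n :=
  i - (({j : ZMod n | Arrow r j i}).ncard : ZMod n)

def Nr {n : ℕ} (r : ZMod n → ℕ) (i : ZMod n) : ZMod n :=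
  if Arrow r i (i + 1) then i + 1 else i

def Nl {n : ℕ} (r : ZMod n → ℕ) (i : ZMod n) : ZMod n :=
  if Arrow r (i - 1) i then i - 1 else i

def Ur {n : ℕ} (r : ZMod n → ℕ) (i : ZMod n) : ZMod n := Fr r i + 1

def Ul {n : ℕ} (r : ZMod n → ℕ) (i : ZMod n) : ZMod n := Fl r i - 1

def IsNormal {n : ℕ} (r : ZMod n → ℕ) : Prop :=
  ∀ i j : ZMod n, i ≠ j → ¬(Arrow r i j ∧ Arrow r j i)

def roundGraph {n : ℕ} (r : ZMod n → ℕ) : SimpleGraph (ZMod n) :=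
  SimpleGraph.fromRel (Arrow r)

def IsStraight {n : ℕ} (r : ZMod n → ℕ) : Prop := ∃ i, r i = 0

def cyclicRange {n : ℕ} (a b : ZMod n) : Set (ZMod n) :=
  {x | ∃ k : ℕ, k ≤ (b - a).val ∧ x = a + (k : ZMod n)}

def cyclicRangeCO {n : ℕ} (a b : ZMod n) : Set (ZMod n) := cyclicRange a b \ {b}

def cyclicRangeOC {n : ℕ} (a b : ZMod n) : Set (ZMod n) := cyclicRange a b \ {a}

def cyclicRangeOO {n : ℕ} (a b : ZMod n) : Set (ZMod n) := cyclicRange a b \ {a, b}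

def coNbhd {V : Type*} (G : SimpleGraph V) (v : V) : Set V :=
  {w | w ≠ v ∧ ¬ G.Adj v w}

def coNbhdSet {V : Type*} (G : SimpleGraph V) (S : Set V) : Set V :=
  ⋃ v ∈ S, coNbhd G v

def IsBipartite {V : Type*} (G : SimpleGraph V) : Prop :=
  ∃ S : Set V, ∀ v w, G.Adj v w → (v ∈ S ↔ w ∉ S)

def IsUniversalPt {n : ℕ} (r : ZMod n → ℕ) (i : ZMod n) : Prop :=
  ∀ j, j ≠ i → (roundGraph r).Adj i j

def Compressed {n : ℕ} (r : ZMod n → ℕ) : Prop :=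
  ∀ i j : ZMod n, Fl r i = Fl r j → Fr r i = Fr r j → i = j

def IsRoundRepOf {V : Type*} (G : SimpleGraph V) (n : ℕ) (r : ZMod n → ℕ)
    (β : V → ZMod n) : Prop :=
  IsRoundRep n r ∧ IsNormal r ∧ Function.Surjective β ∧
    ∀ u v : V, u ≠ v → (G.Adj u v ↔ (β u = β v ∨ (roundGraph r).Adj (β u) (β v)))

def IsPCA {V : Type*} (G : SimpleGraph V) : Prop :=
  ∃ n : ℕ, 1 ≤ n ∧ ∃ (r : ZMod n → ℕ) (β : V → ZMod n), IsRoundRepOf G n r β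

def IsPIG {V : Type*} (G : SimpleGraph V) : Prop :=
  ∃ n : ℕ, 1 ≤ n ∧ ∃ (r : ZMod n → ℕ) (β : V → ZMod n),
    IsRoundRepOf G n r β ∧ IsStraight r

def IsBlockContigOf {V : Type*} (G : SimpleGraph V) (n : ℕ) (r : ZMod n → ℕ)
    (β : V → ZMod n) : Prop :=
  IsRoundRepOf G n r β ∧ Compressed r ∧
    {i : ZMod n | IsUniversalPt r i}.Subsingleton ∧ (roundGraph r).Connected

def Disconnectable {n : ℕ} (r : ZMod n → ℕ) (a b : ZMod n) : Prop :=
  b = Fr r a ∧ a = Fl r b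

def Connectable {n : ℕ} (r : ZMod n → ℕ) (a b : ZMod n) : Prop :=
  b = Ur r a ∧ a = Ul r b

def addEdge {V : Type*} (G : SimpleGraph V) (v w : V) : SimpleGraph V :=
  G ⊔ SimpleGraph.fromRel (fun x y => x = v ∧ y = w)

def IsCoContigChunk {n : ℕ} (r : ZMod n → ℕ) (S : Set (ZMod n)) : Prop :=
  (∃ a b : ZMod n, S = cyclicRange a b) ∧
  ∃ X : Set (ZMod n), S ⊆ X ∧
    (∃ C : ((roundGraph r)ᶜ).ConnectedComponent,
      X ∪ coNbhdSet (roundGraph r) X = C.supp) ∧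
    X ∩ coNbhdSet (roundGraph r) X = ∅ ∧
    (roundGraph r).IsClique X ∧ (roundGraph r).IsClique (coNbhdSet (roundGraph r) X)

def phi {n : ℕ} (w : ZMod (n + 1)) (k : ZMod n) : ZMod (n + 1) :=
  w + 1 + (k.val : ZMod (n + 1))

def removePt {n : ℕ} (s : ZMod (n + 1) → ℕ) (w : ZMod (n + 1)) (k : ZMod n) : ℕ :=
  if Arrow s (phi w k) w then s (phi w k) - 1 else s (phi w k)

def Receptive {n : ℕ} (r : ZMod n → ℕ) (Bl Br : ZMod n) : Prop :=
  ∃ (s : ZMod (n + 1) → ℕ) (w : ZMod (n + 1)),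
    IsRoundRep (n + 1) s ∧ IsNormal s ∧ (roundGraph s).Connected ∧
    Fl s w ≠ w ∧ Fr s w ≠ w ∧ removePt s w = r ∧
    phi w Bl = Fl s w ∧ phi w Br = Fr s w

def dominoGraph : SimpleGraph (Fin 6) :=
  SimpleGraph.fromRel (fun i j =>
    (i, j) = (0, 1) ∨ (i, j) = (1, 2) ∨ (i, j) = (3, 4) ∨ (i, j) = (4, 5) ∨
    (i, j) = (0, 3) ∨ (i, j) = (1, 4) ∨ (i, j) = (2, 5))

def pGraph : SimpleGraph (Fin 5) :=
  SimpleGraph.fromRel (fun i j =>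
    (i, j) = (0, 1) ∨ (i, j) = (1, 2) ∨ (i, j) = (3, 4) ∨
    (i, j) = (0, 3) ∨ (i, j) = (1, 4))

def AlmostConnectable {V : Type*} {n : ℕ} (r : ZMod n → ℕ) (β : V → ZMod n)
    (a b : ZMod n) : Prop :=
  (∃ v : V, β ⁻¹' {a} = {v}) ∧ (∃ w : V, β ⁻¹' {b} = {w}) ∧
  ∃ (hab : a ≠ b) (C : (((roundGraph r).induce {x : ZMod n | x ≠ b})ᶜ).ConnectedComponent)
    (D : Set (ZMod n)),
      (⟨a, hab⟩ : {x : ZMod n | x ≠ b}) ∈ C.supp ∧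
      D = Subtype.val '' C.supp ∧
      Nonempty ((roundGraph r).induce D ≃g pGraphᶜ) ∧
      Nonempty ((roundGraph r).induce (D ∪ {b}) ≃g dominoGraphᶜ) ∧
      Nonempty ((roundGraph r).induce ((D ∪ {b}) \ {a}) ≃g pGraphᶜ)

/-- A nonempty arc of `ZMod n`: the image of an interval of integers. -/
def IsArc {n : ℕ} (A : Set (ZMod n)) : Prop :=
  ∃ u v : ℤ, u ≤ v ∧ A = {x | ∃ z : ℤ, u ≤ z ∧ z ≤ v ∧ x = (z : ZMod n)}

theorem IsArc.exists_eq_cyclicRange {n : ℕ} [NeZero n] {A : Set (ZMod n)} (hA : IsArc A) :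
    ∃ a b : ZMod n, A = cyclicRange a b := by
  obtain ⟨u, v, huv, rfl⟩ := hA
  have hn : 0 < n := Nat.pos_of_ne_zero (NeZero.ne n)
  have hm : min (v - u).toNat (n - 1) < n := by omega
  refine ⟨u, u + (min (v - u).toNat (n - 1) : ℕ), ?_⟩
  ext x
  simp only [cyclicRange, Set.mem_ofPred_eq, add_sub_cancel_left, ZMod.val_natCast_of_lt hm]
  constructor
  · rintro ⟨z, hz, hz', rfl⟩
    refine ⟨(z - u).toNat % n, ?_, ?_⟩
    · have h₁ := Nat.mod_le (z - u).toNat n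
      have h₂ := Nat.mod_lt (z - u).toNat hn
      omega
    · have h : ((z - u).toNat : ℤ) = z - u := Int.toNat_of_nonneg (by omega)
      rw [ZMod.natCast_mod, ← Int.cast_natCast, h]
      push_cast
      ring
  · rintro ⟨k, hk, rfl⟩
    exact ⟨u + k, by omega, by omega, by push_cast; rfl⟩

theorem isArc_singleton {n : ℕ} (x : ZMod n) : IsArc {x} := by
  obtain ⟨z, rfl⟩ := ZMod.intCast_surjective x
  refine ⟨z, z, le_rfl, ?_⟩
  ext y
  simp only [Set.mem_singleton_iff, Set.mem_ofPred_eq]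
  constructor
  · rintro rfl
    exact ⟨z, le_rfl, le_rfl, rfl⟩
  · rintro ⟨w, h₁, h₂, rfl⟩
    rw [le_antisymm h₂ h₁]

theorem IsArc.union {n : ℕ} {A B : Set (ZMod n)} (hA : IsArc A) (hB : IsArc B)
    (h : (A ∩ B).Nonempty) : IsArc (A ∪ B) := by
  obtain ⟨u, v, huv, rfl⟩ := hA
  obtain ⟨u', v', huv', rfl⟩ := hB
  obtain ⟨x, ⟨s, hs, hs', rfl⟩, t, ht, ht', hst⟩ := h
  refine ⟨min u (u' + (s - t)), max v (v' + (s - t)), by omega, ?_⟩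
  ext y
  simp only [Set.mem_union, Set.mem_ofPred_eq]
  constructor
  · rintro (⟨z, hz, hz', rfl⟩ | ⟨z, hz, hz', rfl⟩)
    · exact ⟨z, by omega, by omega, rfl⟩
    · exact ⟨z + (s - t), by omega, by omega, by push_cast; rw [hst]; ring⟩
  · rintro ⟨z, hz, hz', rfl⟩
    by_cases hzA : u ≤ z ∧ z ≤ v
    · exact Or.inl ⟨z, hzA.1, hzA.2, rfl⟩
    · exact Or.inr ⟨z - (s - t), by omega, by omega, by push_cast; rw [hst]; ring⟩

theorem arrow_add_natCast_iff {n : ℕ} {r : ZMod n → ℕ} (hr : ∀ i, r i < n) (x : ZMod n) {k : ℕ}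
    (hk : 1 ≤ k) (hkn : k < n) : Arrow r x (x + k) ↔ k ≤ r x := by
  constructor
  · rintro ⟨m, hm, hm', h⟩
    have h' := congrArg ZMod.val (add_left_cancel h)
    rw [ZMod.val_natCast_of_lt hkn, ZMod.val_natCast_of_lt (hm'.trans_lt (hr x))] at h'
    omega
  · exact fun h => ⟨k, hk, h, rfl⟩

theorem add_natCast_arrow_iff {n : ℕ} {r : ZMod n → ℕ} (hr : ∀ i, r i < n) (x : ZMod n) {k : ℕ}
    (hk : 1 ≤ k) (hkn : k < n) : Arrow r (x + k) x ↔ n - k ≤ r (x + k) := by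
  have h := arrow_add_natCast_iff hr (x + k) (k := n - k) (by omega) (by omega)
  rwa [Nat.cast_sub hkn.le, ZMod.natCast_self, zero_sub, add_neg_cancel_right] at h

theorem compl_roundGraph_adj_add_natCast_iff {n : ℕ} {r : ZMod n → ℕ} (hr : ∀ i, r i < n)
    (x : ZMod n) {k : ℕ} (hk : 1 ≤ k) (hkn : k < n) :
    (roundGraph r)ᶜ.Adj x (x + k) ↔ r x < k ∧ k + r (x + k) < n := by
  have hne : x ≠ x + k := by
    intro h
    have h' := congrArg ZMod.val (left_eq_add.mp h)
    rw [ZMod.val_natCast_of_lt hkn, ZMod.val_zero] at h'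
    omega
  rw [SimpleGraph.compl_adj, roundGraph, SimpleGraph.fromRel_adj,
    arrow_add_natCast_iff hr x hk hkn, add_natCast_arrow_iff hr x hk hkn]
  simp only [hne, ne_eq, not_false_eq_true, true_and]
  omega

theorem monotone_add_of_forall_le_succ {n : ℕ} {r : ZMod n → ℕ} (hr : ∀ i, r i ≤ r (i + 1) + 1)
    (x : ZMod n) : Monotone fun k : ℕ => k + r (x + k) := by
  refine monotone_nat_of_le_succ fun k => ?_
  have h := hr (x + k)
  rw [add_assoc] at h
  push_cast
  omega

theorem neighborSet_compl_roundGraph_isArc {n : ℕ} [NeZero n] {r : ZMod n → ℕ}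
    (hr : IsRoundRep n r) (x : ZMod n) (hne : ((roundGraph r)ᶜ.neighborSet x).Nonempty) :
    IsArc ((roundGraph r)ᶜ.neighborSet x) := by
  let K : Set ℕ := {k | r x < k ∧ k + r (x + k) < n}
  have hmem : ∀ w, (roundGraph r)ᶜ.Adj x w ↔ ∃ k ∈ K, w = x + (k : ZMod n) := by
    intro w
    constructor
    · intro h
      have hw : w = x + ((w - x).val : ZMod n) := by simp
      have hpos : 1 ≤ (w - x).val := by
        rw [Nat.one_le_iff_ne_zero, ne_eq, ZMod.val_eq_zero, sub_eq_zero]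
        exact h.ne'
      rw [hw] at h
      exact ⟨_, (compl_roundGraph_adj_add_natCast_iff hr.1 x hpos (ZMod.val_lt _)).mp h, hw⟩
    · rintro ⟨k, hk, rfl⟩
      exact (compl_roundGraph_adj_add_natCast_iff hr.1 x (by have := hk.1; omega)
        (by have := hk.2; omega)).mpr hk
  obtain ⟨w, hw⟩ := hne
  obtain ⟨k₀, hk₀, -⟩ := (hmem w).mp hw
  have hfin : K.Finite := (Set.finite_lt_nat n).subset fun k hk => by
    have := hk.2
    simp only [Set.mem_ofPred_eq]
    omega
  obtain ⟨t, ht, hmax⟩ := Set.exists_max_image K id hfin ⟨k₀, hk₀⟩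
  have hK : ∀ k, k ∈ K ↔ r x < k ∧ k ≤ t := fun k =>
    ⟨fun hk => ⟨hk.1, hmax k hk⟩,
      fun hk => ⟨hk.1, (monotone_add_of_forall_le_succ hr.2 x hk.2).trans_lt ht.2⟩⟩
  obtain ⟨z, hz⟩ := ZMod.intCast_surjective x
  refine ⟨z + r x + 1, z + t, by have := ht.1; omega, ?_⟩
  ext y
  rw [SimpleGraph.mem_neighborSet, hmem]
  constructor
  · rintro ⟨k, hk, rfl⟩
    rw [hK] at hk
    exact ⟨z + k, by omega, by omega, by push_cast; rw [hz]⟩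
  · rintro ⟨i, hi, hi', rfl⟩
    refine ⟨(i - z).toNat, (hK _).mpr (by omega), ?_⟩
    rw [← Int.cast_natCast, Int.toNat_of_nonneg (by omega), ← hz]
    push_cast
    ring

/-- In a bipartite graph on `ZMod n` all of whose nonempty neighborhoods are arcs, each side of
each connected component is empty or an arc. -/
theorem supp_inter_eq_empty_or_isArc {n : ℕ} [NeZero n] {H : SimpleGraph (ZMod n)}
    (harc : ∀ x, (H.neighborSet x).Nonempty → IsArc (H.neighborSet x)) {S : Set (ZMod n)}
    (hS : ∀ v w, H.Adj v w → (v ∈ S ↔ w ∉ S)) (C : H.ConnectedComponent) :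
    C.supp ∩ S = ∅ ∨ IsArc (C.supp ∩ S) := by
  rcases (C.supp ∩ S).eq_empty_or_nonempty with h | ⟨y, hyC, hyS⟩
  · exact Or.inl h
  right
  have hy : {y} ∈ {A : Set (ZMod n) | IsArc A ∧ A ⊆ C.supp ∩ S} :=
    ⟨isArc_singleton y, Set.singleton_subset_iff.mpr ⟨hyC, hyS⟩⟩
  obtain ⟨A, hyA, hA⟩ := (Set.toFinite _).exists_le_maximal hy
  have hstep : ∀ v, H.Reachable y v → (v ∈ S → v ∈ A) ∧ (v ∉ S → H.neighborSet v ⊆ A) := by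
    intro v hv
    rw [SimpleGraph.reachable_iff_reflTransGen] at hv
    induction hv with
    | refl => exact ⟨fun _ => hyA rfl, fun h => absurd hyS h⟩
    | @tail v w hyv hvw ih =>
      refine ⟨fun hw => ih.2 (fun hv => (hS v w hvw).mp hv hw) hvw, fun hw => ?_⟩
      have hvA := ih.1 ((hS v w hvw).mpr hw)
      have hwC : w ∈ C.supp :=
        (C.mem_supp_congr_adj hvw).mp (hA.prop.2 hvA).1
      have hunion := hA.le_of_ge (y := A ∪ H.neighborSet w)
        ⟨hA.prop.1.union (harc w ⟨v, hvw.symm⟩) ⟨v, hvA, hvw.symm⟩, Set.union_subset hA.prop.2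
          fun u hu => ⟨(C.mem_supp_congr_adj hu).mp hwC,
            by_contra fun h => hw ((hS w u hu).mpr h)⟩⟩ Set.subset_union_left
      exact Set.subset_union_right.trans hunion
  have hAeq : C.supp ∩ S = A := by
    refine Set.Subset.antisymm (fun v hv => (hstep v ?_).1 hv.2) hA.prop.2
    exact SimpleGraph.ConnectedComponent.exact (hyC.trans hv.1.symm)
  rw [hAeq]
  exact hA.prop.1

theorem stmt3 {n : ℕ} (hn : 1 ≤ n) (r : ZMod n → ℕ)
    (hr : IsRoundRep n r) (hnorm : IsNormal r)
    (hbip : IsBipartite ((roundGraph r)ᶜ)) :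
    ∀ C : ((roundGraph r)ᶜ).ConnectedComponent,
      ∃ X Y : Set (ZMod n),
        (X = ∅ ∨ ∃ a b : ZMod n, X = cyclicRange a b) ∧
        (Y = ∅ ∨ ∃ a b : ZMod n, Y = cyclicRange a b) ∧
        X ∪ Y = C.supp ∧ X ∩ Y = ∅ ∧
        Y = coNbhdSet (roundGraph r) X ∧
        (roundGraph r).IsClique X ∧ (roundGraph r).IsClique Y := by
  have : NeZero n := ⟨by omega⟩
  intro C
  obtain ⟨v, hv⟩ := C.nonempty_supp
  obtain ⟨S, hS, hvS⟩ : ∃ S : Set (ZMod n),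
      (∀ v w, (roundGraph r)ᶜ.Adj v w → (v ∈ S ↔ w ∉ S)) ∧ v ∈ S := by
    obtain ⟨S, hS⟩ := hbip
    by_cases hvS : v ∈ S
    · exact ⟨S, hS, hvS⟩
    · exact ⟨Sᶜ, fun a b h => not_congr (hS a b h), hvS⟩
  have hS' : ∀ v w, (roundGraph r)ᶜ.Adj v w → (v ∈ Sᶜ ↔ w ∉ Sᶜ) :=
    fun a b h => not_congr (hS a b h)
  have harc := neighborSet_compl_roundGraph_isArc hr
  have hclique : ∀ T : Set (ZMod n), (∀ v w, (roundGraph r)ᶜ.Adj v w → (v ∈ T ↔ w ∉ T)) →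
      (roundGraph r).IsClique (C.supp ∩ T) := by
    intro T hT a ha b hb hab
    by_contra h
    exact (hT a b ((roundGraph r).compl_adj a b |>.mpr ⟨hab, h⟩)).mp ha.2 hb.2
  refine ⟨C.supp ∩ S, C.supp ∩ Sᶜ,
    (supp_inter_eq_empty_or_isArc harc hS C).imp_right IsArc.exists_eq_cyclicRange,
    (supp_inter_eq_empty_or_isArc harc hS' C).imp_right IsArc.exists_eq_cyclicRange,
    Set.inter_union_compl _ _, ?_, ?_, hclique S hS, hclique Sᶜ hS'⟩
  · ext x
    simp only [Set.mem_inter_iff, Set.mem_compl_iff, Set.mem_empty_iff_false]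
    tauto
  · ext y
    simp only [coNbhdSet, coNbhd, Set.mem_iUnion, Set.mem_ofPred_eq, exists_prop]
    constructor
    · rintro ⟨hyC, hyS⟩
      have hreach : (roundGraph r)ᶜ.Reachable y v :=
        SimpleGraph.ConnectedComponent.exact (hyC.trans hv.symm)
      obtain ⟨p⟩ := hreach
      cases p with
      | nil => exact absurd hvS hyS
      | @cons _ w _ hyw _ =>
        refine ⟨w, ⟨(C.mem_supp_congr_adj hyw).mp hyC, by_contra fun h => hyS ((hS y w hyw).mpr h)⟩,
          ?_⟩
        exact ((roundGraph r).compl_adj w y |>.mp hyw.symm).imp_left Ne.symm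
    · rintro ⟨x, ⟨hxC, hxS⟩, hyx, hadj⟩
      have hxy := (roundGraph r).compl_adj x y |>.mpr ⟨hyx.symm, hadj⟩
      exact ⟨(C.mem_supp_congr_adj hxy).mp hxC, (hS x y hxy).mp hxS⟩
end
end

section
/- If H is a finite PCA graph whose complement is not connected, then the complement of H is bipartite. -/
open Classical

noncomputable section

/-- The reflexive closure of `Arrow r`. -/
def WeakArrow {n : ℕ} (r : ZMod n → ℕ) (i j : ZMod n) : Prop :=
  ∃ k : ℕ, k ≤ r i ∧ j = i + (k : ZMod n)

theorem weakArrow_iff {n : ℕ} (r : ZMod n → ℕ) (i j : ZMod n) :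
    WeakArrow r i j ↔ i = j ∨ Arrow r i j := by
  constructor
  · rintro ⟨k, hk, rfl⟩
    rcases Nat.eq_zero_or_pos k with rfl | hpos
    · simp
    · exact Or.inr ⟨k, hpos, hk, rfl⟩
  · rintro (rfl | ⟨k, -, hk, rfl⟩)
    · exact ⟨0, Nat.zero_le _, by simp⟩
    · exact ⟨k, hk, rfl⟩

theorem eq_or_roundGraph_adj_iff {n : ℕ} (r : ZMod n → ℕ) (i j : ZMod n) :
    (i = j ∨ (roundGraph r).Adj i j) ↔ (WeakArrow r i j ∨ WeakArrow r j i) := by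
  rw [weakArrow_iff, weakArrow_iff, roundGraph, SimpleGraph.fromRel_adj]
  tauto

theorem IsRoundRep.le_add {n : ℕ} {r : ZMod n → ℕ} (hr : IsRoundRep n r) (i : ZMod n) (a : ℕ) :
    r i ≤ r (i + (a : ZMod n)) + a := by
  induction a with
  | zero => simp
  | succ a ih =>
    have h := hr.2 (i + (a : ZMod n))
    rw [add_assoc] at h
    push_cast
    omega

/-- Closed out-neighbourhoods of a round representation are cliques. -/
theorem IsRoundRep.weakArrow_of_left {n : ℕ} {r : ZMod n → ℕ} (hr : IsRoundRep n r)
    {i j k : ZMod n} (hj : WeakArrow r i j) (hk : WeakArrow r i k) :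
    WeakArrow r j k ∨ WeakArrow r k j := by
  obtain ⟨a, ha, rfl⟩ := hj
  obtain ⟨b, hb, rfl⟩ := hk
  have h₁ := hr.le_add i a
  have h₂ := hr.le_add i b
  rcases le_total a b with hab | hab
  · exact Or.inl ⟨b - a, by omega, by rw [Nat.cast_sub hab]; ring⟩
  · exact Or.inr ⟨a - b, by omega, by rw [Nat.cast_sub hab]; ring⟩

/-- Closed in-neighbourhoods are cliques. -/
theorem weakArrow_of_right {n : ℕ} {r : ZMod n → ℕ}
    {i j k : ZMod n} (hj : WeakArrow r j i) (hk : WeakArrow r k i) :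
    WeakArrow r j k ∨ WeakArrow r k j := by
  obtain ⟨a, ha, rfl⟩ := hj
  obtain ⟨b, hb, h⟩ := hk
  rcases le_total a b with hab | hab
  · exact Or.inr ⟨b - a, by omega, by rw [Nat.cast_sub hab]; linear_combination h⟩
  · exact Or.inl ⟨a - b, by omega, by rw [Nat.cast_sub hab]; linear_combination -h⟩

theorem exists_not_reachable {V : Type*} [Nonempty V] {G : SimpleGraph V}
    (hG : ¬ G.Connected) (v : V) : ∃ w, ¬ G.Reachable v w := by
  by_contra! h
  exact hG ((SimpleGraph.connected_iff _).2 ⟨fun a b => (h a).symm.trans (h b), ‹_›⟩)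

theorem stmt4 {V : Type*} [Fintype V] (H : SimpleGraph V) (hpca : IsPCA H)
    (hncc : ¬ (Hᶜ).Connected) : IsBipartite (Hᶜ) := by
  obtain ⟨n, -, r, β, hr, -, hβ, hadj⟩ := hpca
  have : Nonempty V := ⟨(hβ 0).choose⟩
  simp only [eq_or_roundGraph_adj_iff] at hadj
  have hout : ∀ C : (Hᶜ).ConnectedComponent, ∃ p, (Hᶜ).connectedComponentMk p ≠ C := by
    refine SimpleGraph.ConnectedComponent.ind fun v => ?_
    obtain ⟨w, hw⟩ := exists_not_reachable hncc v
    exact ⟨w, fun h => hw (SimpleGraph.ConnectedComponent.exact h).symm⟩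
  choose p hp using hout
  have hpadj : ∀ u, WeakArrow r (β (p ((Hᶜ).connectedComponentMk u))) (β u) ∨
      WeakArrow r (β u) (β (p ((Hᶜ).connectedComponentMk u))) := by
    intro u
    set q := p ((Hᶜ).connectedComponentMk u)
    have hne : (Hᶜ).connectedComponentMk q ≠ (Hᶜ).connectedComponentMk u := hp _
    have hqu : q ≠ u := fun h => hne (congrArg _ h)
    refine (hadj q u hqu).1 ?_
    by_contra hn
    exact hne (SimpleGraph.ConnectedComponent.sound
      (((SimpleGraph.compl_adj H q u).2 ⟨hqu, hn⟩).reachable))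
  refine ⟨{u | WeakArrow r (β (p ((Hᶜ).connectedComponentMk u))) (β u)}, fun v w hvw => ?_⟩
  obtain ⟨hne, hn⟩ := (SimpleGraph.compl_adj H v w).1 hvw
  rw [hadj v w hne] at hn
  have hv := hpadj v
  have hw := hpadj w
  simp only [Set.mem_ofPred_eq]
  rw [← SimpleGraph.ConnectedComponent.sound hvw.reachable] at hw ⊢
  constructor
  · exact fun h₁ h₂ => hn (hr.weakArrow_of_left h₁ h₂)
  · intro h₂
    by_contra h₁
    exact hn (weakArrow_of_right (hv.resolve_left h₁) (hw.resolve_left h₂))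
end
end

section
/- Let r be a normal round representation on ZMod n. Then no two distinct points have equal closed neighborhoods in 𝒢(r) if and only if r is compressed and 𝒢(r) has at most one universal point. -/
open Classical

noncomputable section

/-- The number of points with an arrow to `i`. -/
def inDegree {n : ℕ} (r : ZMod n → ℕ) (i : ZMod n) : ℕ :=
  {j : ZMod n | Arrow r j i}.ncard

/-- Two multiples of `1` in `ZMod n` with coefficients below `n` agree only if the coefficients do. -/
theorem natCast_inj_of_lt {n k l : ℕ} (hk : k < n) (hl : l < n)
    (h : (k : ZMod n) = (l : ZMod n)) : k = l := by
  have h' := (ZMod.natCast_eq_natCast_iff' k l n).1 h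
  rwa [Nat.mod_eq_of_lt hk, Nat.mod_eq_of_lt hl] at h'

/-- The points with an arrow to `i` are exactly the `inDegree r i` points just before `i`. -/
theorem inDegree_lt_and_arrow_iff {n : ℕ} {r : ZMod n → ℕ}
    (hr : IsRoundRep n r) (i : ZMod n) :
    inDegree r i < n ∧
      ∀ j, Arrow r j i ↔ ∃ k : ℕ, 1 ≤ k ∧ k ≤ inDegree r i ∧ j = i - (k : ZMod n) := by
  obtain ⟨M, hMn, hM⟩ : ∃ M, M < n ∧ ∀ k : ℕ, k ≤ r (i - (k : ZMod n)) ↔ k ≤ M := by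
    let P : ℕ → Prop := fun k => k ≤ r (i - (k : ZMod n))
    have hP0 : P 0 := Nat.zero_le _
    have hspec : P (Nat.findGreatest P n) := Nat.findGreatest_spec (Nat.zero_le n) hP0
    have hdown : ∀ k, P (k + 1) → P k := by
      intro k hk
      have h := hr.2 (i - ((k + 1 : ℕ) : ZMod n))
      have he : i - ((k + 1 : ℕ) : ZMod n) + 1 = i - (k : ZMod n) := by push_cast; ring
      rw [he] at h
      simp only [P] at hk ⊢
      omega
    refine ⟨Nat.findGreatest P n, lt_of_le_of_lt hspec (hr.1 _),
      fun k => ⟨fun hk => ?_, fun hk => ?_⟩⟩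
    · exact Nat.le_findGreatest (hk.trans (hr.1 _).le) hk
    · exact Nat.decreasingInduction' (fun m _ _ h => hdown m h) hk hspec
  have harrow : ∀ j, Arrow r j i ↔ ∃ k : ℕ, 1 ≤ k ∧ k ≤ M ∧ j = i - (k : ZMod n) := by
    intro j
    constructor
    · rintro ⟨k, h1, h2, h3⟩
      have hj : j = i - (k : ZMod n) := by rw [h3]; ring
      exact ⟨k, h1, (hM k).1 (hj ▸ h2), hj⟩
    · rintro ⟨k, h1, h2, rfl⟩
      exact ⟨k, h1, (hM k).2 h2, by ring⟩
  have hcard : inDegree r i = M := by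
    have hset : {j : ZMod n | Arrow r j i} =
        ((Finset.Icc 1 M).image fun k : ℕ => i - (k : ZMod n) : Finset (ZMod n)) := by
      ext j
      simp only [Set.mem_ofPred_eq, harrow, Finset.coe_image, Set.mem_image, Finset.coe_Icc,
        Set.mem_Icc, and_assoc, eq_comm]
    rw [inDegree, hset, Set.ncard_coe_finset, Finset.card_image_of_injOn, Nat.card_Icc,
      Nat.add_sub_cancel]
    intro k hk l hl h
    simp only [Finset.coe_Icc, Set.mem_Icc] at hk hl
    exact natCast_inj_of_lt (by omega) (by omega) (sub_right_injective h)
  rw [hcard]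
  exact ⟨hMn, harrow⟩

/-- In a normal round representation, the in- and out-neighbors of a point do not wrap around. -/
theorem inDegree_add_lt {n : ℕ} {r : ZMod n → ℕ}
    (hr : IsRoundRep n r) (hnorm : IsNormal r) (i : ZMod n) : inDegree r i + r i < n := by
  obtain ⟨hlt, harrow⟩ := inDegree_lt_and_arrow_iff hr i
  have hri := hr.1 i
  by_contra! h
  refine hnorm i (i + (r i : ZMod n)) (fun he => ?_) ⟨⟨r i, by omega, le_rfl, rfl⟩, (harrow _).2
    ⟨n - r i, by omega, by omega, ?_⟩⟩
  · have h0 : r i = 0 := natCast_inj_of_lt hri (by omega) (by simpa using he.symm)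
    omega
  · rw [Nat.cast_sub hri.le]
    simp

/-- The closed neighborhood of `i` is the cyclic range from `Fl r i` to `Fr r i`. -/
theorem neighborSet_union_singleton_eq_cyclicRange {n : ℕ} {r : ZMod n → ℕ}
    (hr : IsRoundRep n r) (hnorm : IsNormal r) (i : ZMod n) :
    (roundGraph r).neighborSet i ∪ {i} = cyclicRange (Fl r i) (Fr r i) := by
  have hlt := inDegree_add_lt hr hnorm i
  have harrow := (inDegree_lt_and_arrow_iff hr i).2
  have hFl : Fl r i = i - (inDegree r i : ZMod n) := rfl
  have hval : (Fr r i - Fl r i).val = inDegree r i + r i := by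
    rw [← ZMod.val_natCast_of_lt hlt, hFl, Fr]
    congr 1
    push_cast
    ring
  ext x
  simp only [roundGraph, Set.mem_union, SimpleGraph.mem_neighborSet, SimpleGraph.fromRel_adj,
    Set.mem_singleton_iff, cyclicRange, Set.mem_ofPred_eq, harrow]
  rw [hval, hFl]
  constructor
  · rintro (⟨-, ⟨k, -, hk, rfl⟩ | ⟨k, -, hk, rfl⟩⟩ | rfl)
    · exact ⟨inDegree r i + k, by omega, by push_cast; ring⟩
    · exact ⟨inDegree r i - k, by omega, by rw [Nat.cast_sub hk]; ring⟩
    · exact ⟨inDegree r x, by omega, by ring⟩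
  · rintro ⟨k, hk, hx⟩
    by_cases hxi : x = i
    · exact Or.inr hxi
    refine Or.inl ⟨Ne.symm hxi, ?_⟩
    rcases lt_trichotomy k (inDegree r i) with h | h | h
    · exact Or.inr ⟨inDegree r i - k, by omega, by omega, by rw [hx, Nat.cast_sub h.le]; ring⟩
    · exact absurd (by rw [hx, h]; ring) hxi
    · exact Or.inl ⟨k - inDegree r i, by omega, by omega, by rw [hx, Nat.cast_sub h.le]; ring⟩

/-- A cyclic range containing the predecessor of its first point is everything. -/
theorem cyclicRange_eq_univ_of_sub_one_mem {n : ℕ} [NeZero n] {a b : ZMod n}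
    (h : a - 1 ∈ cyclicRange a b) : cyclicRange a b = Set.univ := by
  obtain ⟨k, hk, hka⟩ := h
  have hlt := ZMod.val_lt (b - a)
  have h0 : ((k + 1 : ℕ) : ZMod n) = 0 := by
    push_cast
    linear_combination -hka
  have hdvd := (ZMod.natCast_eq_zero_iff _ _).1 h0
  have hle := Nat.le_of_dvd (Nat.succ_pos k) hdvd
  refine Set.eq_univ_of_forall fun x => ⟨(x - a).val, ?_, ?_⟩
  · have := ZMod.val_lt (x - a)
    omega
  · rw [ZMod.natCast_zmod_val]
    ring

theorem left_mem_cyclicRange {n : ℕ} (a b : ZMod n) : a ∈ cyclicRange a b :=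
  ⟨0, Nat.zero_le _, by simp⟩

/-- A proper cyclic range determines its first point. -/
theorem left_eq_of_cyclicRange_eq {n : ℕ} [NeZero n] {a b c d : ZMod n}
    (h : cyclicRange a b = cyclicRange c d) (hne : cyclicRange a b ≠ Set.univ) : a = c := by
  obtain ⟨k, hk, hc⟩ : c ∈ cyclicRange a b := h ▸ left_mem_cyclicRange c d
  rcases k with _ | k
  · simpa using hc.symm
  · refine absurd (h.trans (cyclicRange_eq_univ_of_sub_one_mem ?_)) hne
    rw [← h]
    exact ⟨k, by omega, by rw [hc]; push_cast; ring⟩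

theorem val_le_of_cyclicRange_subset {n : ℕ} [NeZero n] {a b d : ZMod n}
    (h : cyclicRange a b ⊆ cyclicRange a d) : (b - a).val ≤ (d - a).val := by
  obtain ⟨k, hk, hb⟩ := h ⟨(b - a).val, le_rfl, rfl⟩
  have hd := ZMod.val_lt (d - a)
  have := natCast_inj_of_lt (ZMod.val_lt (b - a)) (by omega) (add_left_cancel hb)
  omega

/-- A proper cyclic range determines its last point. -/
theorem right_eq_of_cyclicRange_eq {n : ℕ} [NeZero n] {a b c d : ZMod n}
    (h : cyclicRange a b = cyclicRange c d) (hne : cyclicRange a b ≠ Set.univ) : b = d := by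
  obtain rfl := left_eq_of_cyclicRange_eq h hne
  have := ZMod.val_injective n
    ((val_le_of_cyclicRange_subset h.subset).antisymm (val_le_of_cyclicRange_subset h.symm.subset))
  simpa using this

theorem isUniversalPt_iff {n : ℕ} {r : ZMod n → ℕ} {i : ZMod n} :
    IsUniversalPt r i ↔ (roundGraph r).neighborSet i ∪ {i} = Set.univ := by
  rw [Set.eq_univ_iff_forall]
  refine forall_congr' fun j => ?_
  rw [Set.mem_union, SimpleGraph.mem_neighborSet, Set.mem_singleton_iff]
  tauto

theorem stmt5 {n : ℕ} (hn : 1 ≤ n) (r : ZMod n → ℕ)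
    (hr : IsRoundRep n r) (hnorm : IsNormal r) :
    (∀ i j : ZMod n,
        (roundGraph r).neighborSet i ∪ {i} = (roundGraph r).neighborSet j ∪ {j} → i = j) ↔
      (Compressed r ∧ {i : ZMod n | IsUniversalPt r i}.Subsingleton) := by
  have : NeZero n := ⟨by omega⟩
  have hN := neighborSet_union_singleton_eq_cyclicRange hr hnorm
  constructor
  · refine fun h => ⟨fun i j hl hr' => h i j (by rw [hN, hN, hl, hr']), fun i hi j hj => ?_⟩
    exact h i j ((isUniversalPt_iff.1 hi).trans (isUniversalPt_iff.1 hj).symm)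
  · rintro ⟨hcomp, huniv⟩ i j hij
    by_cases hi : IsUniversalPt r i
    · exact huniv hi (isUniversalPt_iff.2 (hij.symm.trans (isUniversalPt_iff.1 hi)))
    · rw [isUniversalPt_iff, hN] at hi
      rw [hN, hN] at hij
      exact hcomp i j (left_eq_of_cyclicRange_eq hij hi) (right_eq_of_cyclicRange_eq hij hi)
end
end

section
/- Let s be a normal round representation on ZMod (n+1) with 𝒢(s) connected, let w be a point, let Γ = s ∖ w, and let b_l be a point of ZMod (n+1) with b_l ≠ w; write k_l for the point of ZMod n with φ k_l = b_l and set b_r = φ (N_r k_l computed in Γ). If b_l and b_r are not indistinguishable in s, but k_l and N_r k_l (in Γ) are indistinguishable in Γ, then the unordered pair {b_l, b_r} equals one of {U_l w, F_l w}, {F_r w, U_r w}, or {N_l w, N_r w}, all computed in s. Moreover, if at most one point of the closed neighborhood of w in 𝒢(s) is universal in 𝒢(s), then {b_l, b_r} ≠ {N_l w, N_r w}. -/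
open Classical

noncomputable section

/-- Arrows of a round representation in terms of offsets from a base point `p`. -/
lemma arrow_offset_iff {m : ℕ} [NeZero m] {r : ZMod m → ℕ} (hr : ∀ i, r i < m) (p : ZMod m)
    {a b : ℕ} (ha : a < m) (hb : b < m) :
    Arrow r (p + a) (p + b) ↔
      (a < b ∧ b ≤ a + r (p + a)) ∨ (b < a ∧ b + m ≤ a + r (p + a)) := by
  have hra := hr (p + a)
  constructor
  · rintro ⟨k, hk1, hk2, hk⟩
    have hmod : b % m = (a + k) % m := by
      rw [← Nat.ModEq, ← ZMod.natCast_eq_natCast_iff]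
      push_cast
      rw [add_assoc] at hk
      exact add_left_cancel hk
    rw [Nat.mod_eq_of_lt hb] at hmod
    rcases lt_or_ge (a + k) m with h | h
    · rw [Nat.mod_eq_of_lt h] at hmod
      omega
    · rw [Nat.mod_eq_sub_mod h, Nat.mod_eq_of_lt (by omega)] at hmod
      omega
  · rintro (⟨h1, h2⟩ | ⟨h1, h2⟩)
    · refine ⟨b - a, by omega, by omega, ?_⟩
      rw [add_assoc, ← Nat.cast_add]
      congr 2
      omega
    · refine ⟨b + m - a, by omega, by omega, ?_⟩
      rw [add_assoc, ← Nat.cast_add, show a + (b + m - a) = b + m by omega]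
      simp

lemma not_arrow_self {m : ℕ} [NeZero m] {r : ZMod m → ℕ} (hr : ∀ i, r i < m) (i : ZMod m) :
    ¬ Arrow r i i := by
  have h := arrow_offset_iff hr i (NeZero.pos m) (NeZero.pos m)
  simp only [Nat.cast_zero, add_zero] at h
  rw [h]
  omega

lemma ncard_arrow_lt {m : ℕ} [NeZero m] {r : ZMod m → ℕ} (hr : ∀ i, r i < m) (i : ZMod m) :
    {j | Arrow r j i}.ncard < m := by
  have hss : {j | Arrow r j i} ⊂ Set.univ :=
    Set.ssubset_univ_iff.2 fun h =>
      not_arrow_self hr i (h ▸ Set.mem_univ i : i ∈ {j | Arrow r j i})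
  simpa [Set.ncard_univ, Nat.card_eq_fintype_card, ZMod.card] using Set.ncard_lt_ncard hss

lemma phi_eq_add_offset {n : ℕ} (w : ZMod (n + 1)) (k : ZMod n) :
    phi w k = w + ((k.val + 1 : ℕ) : ZMod (n + 1)) := by
  simp only [phi]
  push_cast
  ring

lemma add_natCast_inj {m : ℕ} (p : ZMod m) {a b : ℕ} (ha : a < m) (hb : b < m)
    (h : p + (a : ZMod m) = p + b) : a = b := by
  have h := add_left_cancel h
  rw [ZMod.natCast_eq_natCast_iff] at h
  exact Nat.ModEq.eq_of_lt_of_lt h ha hb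

lemma exists_offset {m : ℕ} [NeZero m] (p x : ZMod m) : ∃ a < m, x = p + (a : ZMod m) :=
  ⟨(x - p).val, ZMod.val_lt _, by simp⟩

lemma phi_injective {n : ℕ} [NeZero n] (w : ZMod (n + 1)) : Function.Injective (phi w) := by
  intro j k h
  rw [phi_eq_add_offset, phi_eq_add_offset] at h
  have hj := ZMod.val_lt j
  have hk := ZMod.val_lt k
  have := add_natCast_inj w (by omega) (by omega) h
  exact ZMod.val_injective n (by omega)

lemma phi_ne {n : ℕ} [NeZero n] (w : ZMod (n + 1)) (k : ZMod n) : phi w k ≠ w := by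
  intro h
  rw [phi_eq_add_offset] at h
  have hk := ZMod.val_lt k
  have := add_natCast_inj w (a := k.val + 1) (b := 0) (by omega) (by omega) (by simpa using h)
  omega

lemma exists_phi_eq {n : ℕ} [NeZero n] {w x : ZMod (n + 1)} (hx : x ≠ w) :
    ∃ k : ZMod n, phi w k = x := by
  obtain ⟨a, ha, rfl⟩ := exists_offset w x
  have ha0 : a ≠ 0 := by
    rintro rfl
    simp at hx
  refine ⟨((a - 1 : ℕ) : ZMod n), ?_⟩
  rw [phi_eq_add_offset, ZMod.val_natCast_of_lt (by omega), Nat.sub_add_cancel (by omega)]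

lemma arrow_to_base_iff {n : ℕ} {s : ZMod (n + 1) → ℕ} (hs : ∀ i, s i < n + 1)
    (w : ZMod (n + 1)) {a : ℕ} (ha : a < n + 1) :
    Arrow s (w + a) w ↔ n + 1 ≤ a + s (w + a) := by
  have h := arrow_offset_iff hs w ha (b := 0) (by omega)
  have := hs (w + a)
  simp only [Nat.cast_zero, add_zero] at h
  rw [h]
  omega

lemma arrow_from_base_iff {n : ℕ} {s : ZMod (n + 1) → ℕ} (hs : ∀ i, s i < n + 1)
    (w : ZMod (n + 1)) {a : ℕ} (ha : a < n + 1) :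
    Arrow s w (w + a) ↔ 0 < a ∧ a ≤ s w := by
  have h := arrow_offset_iff hs w (a := 0) (by omega) ha
  simp only [Nat.cast_zero, add_zero] at h
  rw [h]
  omega

lemma removePt_eq_ite {n : ℕ} [NeZero n] {s : ZMod (n + 1) → ℕ} (hs : ∀ i, s i < n + 1)
    (w : ZMod (n + 1)) (k : ZMod n) :
    removePt s w k =
      if n + 1 ≤ (k.val + 1) + s (phi w k) then s (phi w k) - 1 else s (phi w k) := by
  have hk := ZMod.val_lt k
  have h := arrow_to_base_iff hs w (a := k.val + 1) (by omega)
  rw [← phi_eq_add_offset] at h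
  simp only [removePt, h]

lemma removePt_lt {n : ℕ} [NeZero n] {s : ZMod (n + 1) → ℕ} (hs : ∀ i, s i < n + 1)
    (w : ZMod (n + 1)) (k : ZMod n) : removePt s w k < n := by
  have hk := ZMod.val_lt k
  have := hs (phi w k)
  rw [removePt_eq_ite hs]
  split_ifs <;> omega

lemma arrow_removePt_iff {n : ℕ} [NeZero n] {s : ZMod (n + 1) → ℕ} (hs : ∀ i, s i < n + 1)
    (w : ZMod (n + 1)) (j k : ZMod n) :
    Arrow (removePt s w) j k ↔ Arrow s (phi w j) (phi w k) := by
  have hj := ZMod.val_lt j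
  have hk := ZMod.val_lt k
  have h1 := arrow_offset_iff (removePt_lt hs w) 0 hj hk
  have h2 := arrow_offset_iff hs w (a := j.val + 1) (b := k.val + 1) (by omega) (by omega)
  rw [← phi_eq_add_offset, ← phi_eq_add_offset] at h2
  simp only [zero_add, ZMod.natCast_zmod_val, removePt_eq_ite hs] at h1
  have := hs (phi w j)
  rw [h1, h2]
  split_ifs <;> omega

/-- Removing `w` lowers the in-degree by one exactly at the out-neighbors of `w`. -/
lemma ncard_arrow_removePt {n : ℕ} [NeZero n] {s : ZMod (n + 1) → ℕ} (hs : ∀ i, s i < n + 1)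
    (w : ZMod (n + 1)) (k : ZMod n) :
    {x | Arrow s x (phi w k)}.ncard =
      {j | Arrow (removePt s w) j k}.ncard + if Arrow s w (phi w k) then 1 else 0 := by
  have himage : phi w '' {j | Arrow (removePt s w) j k} = {x | Arrow s x (phi w k)} \ {w} := by
    ext x
    simp only [Set.mem_image, Set.mem_ofPred_eq, Set.mem_sdiff, Set.mem_singleton_iff,
      arrow_removePt_iff hs]
    constructor
    · rintro ⟨j, hj, rfl⟩
      exact ⟨hj, phi_ne w j⟩
    · rintro ⟨hx, hxw⟩
      obtain ⟨j, rfl⟩ := exists_phi_eq hxw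
      exact ⟨j, hx, rfl⟩
  rw [← Set.ncard_image_of_injective _ (phi_injective w), himage]
  split_ifs with h
  · exact (Set.ncard_sdiff_singleton_add_one (s := {x | Arrow s x (phi w k)}) h).symm
  · rw [Set.sdiff_singleton_eq_self (s := {x | Arrow s x (phi w k)}) h, add_zero]

/-- If `w + c` is the first point with an arrow to `w`, it is the left far neighbor of `w`. -/
lemma Fl_eq_of_arrow_iff {n : ℕ} {s : ZMod (n + 1) → ℕ} (w : ZMod (n + 1)) {c : ℕ}
    (hc : c ≤ n + 1) (h : ∀ a < n + 1, Arrow s (w + a) w ↔ c ≤ a) : Fl s w = w + c := by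
  have hset : {x | Arrow s x w} =
      (fun a : ℕ => w + (a : ZMod (n + 1))) '' (Finset.Ico c (n + 1)) := by
    ext x
    obtain ⟨a, ha, rfl⟩ := exists_offset w x
    simp only [Set.mem_ofPred_eq, h a ha, Set.mem_image, Finset.coe_Ico, Set.mem_Ico]
    constructor
    · exact fun hca => ⟨a, ⟨hca, ha⟩, rfl⟩
    · rintro ⟨a', ⟨h1, h2⟩, h3⟩
      exact add_natCast_inj w h2 ha h3 ▸ h1
  have hinj : Set.InjOn (fun a : ℕ => w + (a : ZMod (n + 1))) (Finset.Ico c (n + 1)) := by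
    intro a ha b hb hab
    simp only [Finset.coe_Ico, Set.mem_Ico] at ha hb
    exact add_natCast_inj w ha.2 hb.2 hab
  rw [Fl, hset, hinj.ncard_image, Set.ncard_coe_finset, Nat.card_Ico,
    Nat.cast_sub hc]
  simp

lemma eq_succ_of_natCast_eq {m a b : ℕ} (ha : a < m) (ha0 : 0 < a) (hb : b < m)
    (h : (a : ZMod m) = b + 1) : a = b + 1 := by
  have h' : a % m = (b + 1) % m := by
    rw [← Nat.ModEq, ← ZMod.natCast_eq_natCast_iff]
    exact_mod_cast h
  rw [Nat.mod_eq_of_lt ha] at h'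
  rcases (show b + 1 < m ∨ b + 1 = m by omega) with h1 | h1
  · rwa [Nat.mod_eq_of_lt h1] at h'
  · rw [h1, Nat.mod_self] at h'
    omega

lemma val_add_one_eq {m : ℕ} (hm : 1 < m) (k : ZMod m) :
    (k.val + 1 < m ∧ (k + 1).val = k.val + 1) ∨ (k.val + 1 = m ∧ (k + 1).val = 0) := by
  have : NeZero m := ⟨by omega⟩
  have : Fact (1 < m) := ⟨hm⟩
  have hk := ZMod.val_lt k
  have h := ZMod.val_add k 1
  rw [ZMod.val_one] at h
  rcases (show k.val + 1 < m ∨ k.val + 1 = m by omega) with h1 | h1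
  · exact Or.inl ⟨h1, by rw [h, Nat.mod_eq_of_lt h1]⟩
  · exact Or.inr ⟨h1, by rw [h, h1, Nat.mod_self]⟩

lemma monotone_offset_reach {m : ℕ} {r : ZMod m → ℕ} (hr : ∀ i, r i ≤ r (i + 1) + 1)
    (p : ZMod m) : Monotone fun a : ℕ => a + r (p + a) := by
  refine monotone_nat_of_le_succ fun a => ?_
  have h := hr (p + a)
  rw [add_assoc, ← Nat.cast_add_one] at h
  omega

/-- If a point `k` and its distinct near neighbor become indistinguishable by removing `w`, then
they are consecutive and bound the far end of one of the two arrow ranges of `w`. -/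
lemma eq_Fl_or_eq_Fr_of_indistinguishable {n : ℕ} (hn : 1 < n) {s : ZMod (n + 1) → ℕ}
    (hs : IsRoundRep (n + 1) s) (hnorm : IsNormal s) (w : ZMod (n + 1)) (k : ZMod n)
    (harrow : Arrow (removePt s w) k (k + 1))
    (hnotind : ¬ (Fl s (phi w k) = Fl s (phi w (k + 1)) ∧ Fr s (phi w k) = Fr s (phi w (k + 1))))
    (hFl : Fl (removePt s w) k = Fl (removePt s w) (k + 1))
    (hFr : Fr (removePt s w) k = Fr (removePt s w) (k + 1)) :
    phi w (k + 1) = phi w k + 1 ∧ (Fl s w = phi w (k + 1) ∨ Fr s w = phi w k) := by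
  have : NeZero n := ⟨by omega⟩
  obtain ⟨hlt, hmono⟩ := hs
  have hk := ZMod.val_lt k
  have hb := phi_eq_add_offset w k
  have hc := phi_eq_add_offset w (k + 1)
  have hbc := (arrow_removePt_iff hlt w k (k + 1)).1 harrow
  have hgpos : 0 < removePt s w k := by
    obtain ⟨j, hj1, hj2, -⟩ := harrow
    omega
  have hg : removePt s w k = removePt s w (k + 1) + 1 := by
    refine eq_succ_of_natCast_eq (removePt_lt hlt w k) hgpos (removePt_lt hlt w (k + 1)) ?_
    simp only [Fr] at hFr
    linear_combination hFr
  have hd : {j | Arrow (removePt s w) j (k + 1)}.ncard =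
      {j | Arrow (removePt s w) j k}.ncard + 1 := by
    refine eq_succ_of_natCast_eq (ncard_arrow_lt (removePt_lt hlt w) _) ?_
      (ncard_arrow_lt (removePt_lt hlt w) _) ?_
    · exact (Set.ncard_pos).2 ⟨k, harrow⟩
    · simp only [Fl] at hFl
      linear_combination hFl
  have hdb := ncard_arrow_removePt hlt w k
  have hdc := ncard_arrow_removePt hlt w (k + 1)
  have hgb := removePt_eq_ite hlt w k
  have hgc := removePt_eq_ite hlt w (k + 1)
  have hwb := arrow_from_base_iff hlt w (a := k.val + 1) (by omega)
  have hwc := arrow_from_base_iff hlt w (a := (k + 1).val + 1)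
    (by have := ZMod.val_lt (k + 1); omega)
  rw [← hb] at hwb
  rw [← hc] at hwc
  have htb := hlt (phi w k)
  have htc := hlt (phi w (k + 1))
  have htw := hlt w
  rcases val_add_one_eq hn k with ⟨hk1, hk2⟩ | ⟨hk1, hk2⟩
  · have hcb : phi w (k + 1) = phi w k + 1 := by
      rw [hb, hc, hk2]
      push_cast
      ring
    have hm := hmono (phi w k)
    rw [← hcb] at hm
    refine ⟨hcb, ?_⟩
    by_cases hFl' : Fl s (phi w k) = Fl s (phi w (k + 1))
    · left
      have hFr' : s (phi w k) ≠ s (phi w (k + 1)) + 1 := by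
        intro h
        refine hnotind ⟨hFl', ?_⟩
        simp only [Fr, h, hcb]
        push_cast
        ring
      have hfb : k.val + 1 + s (phi w k) = n ∧ k.val + 2 + s (phi w (k + 1)) = n + 1 := by
        rw [hk2] at hgc
        split_ifs at hgb hgc <;> omega
      have hmon := monotone_offset_reach hmono w
      rw [hc, hk2]
      refine Fl_eq_of_arrow_iff w (by omega) fun a ha => ?_
      rw [arrow_to_base_iff hlt w ha]
      rw [hb] at hfb
      rw [hc, hk2] at hfb
      constructor
      · intro h
        by_contra hlt'
        have := hmon (show a ≤ k.val + 1 by omega)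
        simp only at this
        omega
      · intro h
        have := hmon h
        simp only at this
        omega
    · right
      have hd' : {x | Arrow s x (phi w (k + 1))}.ncard ≠ {x | Arrow s x (phi w k)}.ncard + 1 := by
        intro h
        refine hFl' ?_
        rw [Fl, Fl, h, hcb]
        push_cast
        ring
      have hsw : s w = k.val + 1 := by
        rw [hk2] at hwc
        split_ifs at hdb hdc <;> simp_all <;> omega
      rw [Fr, hsw, ← hb]
  · exfalso
    have hb1 : phi w k + 1 = w := by
      rw [hb, hk1, add_assoc, ← Nat.cast_add_one, ZMod.natCast_self, add_zero]
    have hc1 : phi w (k + 1) = w + 1 := by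
      rw [hc, hk2]
      simp
    have hm1 := hmono (phi w k)
    have hm2 := hmono w
    rw [hb1] at hm1
    rw [← hc1] at hm2
    have hfr : s (phi w k) = s (phi w (k + 1)) + 2 := by
      rw [hk2] at hgc
      split_ifs at hgb hgc <;> omega
    have hbw : Arrow s (phi w k) w := ⟨1, le_rfl, by omega, by simp [hb1]⟩
    have hnwb : ¬ Arrow s w (phi w k) := fun h => hnorm _ _ (phi_ne w k) ⟨hbw, h⟩
    have hwc' : Arrow s w (phi w (k + 1)) := ⟨1, le_rfl, by omega, by simp [hc1]⟩
    rw [if_neg hnwb] at hdb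
    rw [if_pos hwc'] at hdc
    have hcb : phi w (k + 1) = phi w k + 2 := by
      linear_combination hc1 - hb1
    refine hnotind ⟨?_, ?_⟩
    · rw [Fl, Fl, hdb, hdc, hd, hcb]
      push_cast
      ring
    · simp only [Fr, hfr, hcb]
      push_cast
      ring

lemma isUniversalPt_of_three {s : ZMod 3 → ℕ} (h : ∀ i, 1 ≤ s i) (i : ZMod 3) :
    IsUniversalPt s i := by
  intro j hj
  have hji : j = i + 1 ∨ i = j + 1 := by
    revert i j
    decide
  refine (SimpleGraph.fromRel_adj _ _ _).2 ⟨hj.symm, ?_⟩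
  rcases hji with e | e
  · exact Or.inl ⟨1, le_rfl, h i, by simp [e]⟩
  · exact Or.inr ⟨1, le_rfl, h j, by simp [e]⟩

theorem stmt8 {n : ℕ} (hn : 1 ≤ n) (s : ZMod (n + 1) → ℕ)
    (hs : IsRoundRep (n + 1) s) (hnorm : IsNormal s)
    (hconn : (roundGraph s).Connected)
    (w bl : ZMod (n + 1)) (hblw : bl ≠ w)
    (kl : ZMod n) (hkl : phi w kl = bl)
    (br : ZMod (n + 1)) (hbr : br = phi w (Nr (removePt s w) kl))
    (hnotind : ¬ (Fl s bl = Fl s br ∧ Fr s bl = Fr s br))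
    (hind : Fl (removePt s w) kl = Fl (removePt s w) (Nr (removePt s w) kl) ∧
            Fr (removePt s w) kl = Fr (removePt s w) (Nr (removePt s w) kl)) :
    (({bl, br} : Set (ZMod (n + 1))) = {Ul s w, Fl s w} ∨
     ({bl, br} : Set (ZMod (n + 1))) = {Fr s w, Ur s w} ∨
     ({bl, br} : Set (ZMod (n + 1))) = {Nl s w, Nr s w}) ∧
    ({x : ZMod (n + 1) | x ∈ (roundGraph s).neighborSet w ∪ {w} ∧
        IsUniversalPt s x}.Subsingleton →
      ({bl, br} : Set (ZMod (n + 1))) ≠ {Nl s w, Nr s w}) := by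

  have : NeZero n := ⟨by omega⟩
  subst hbr
  subst hkl
  have hNr : Nr (removePt s w) kl ≠ kl := by
    intro h
    rw [h] at hnotind
    exact hnotind ⟨rfl, rfl⟩
  have harrow : Arrow (removePt s w) kl (kl + 1) := by
    by_contra h
    exact hNr (if_neg h)
  rw [show Nr (removePt s w) kl = kl + 1 from if_pos harrow] at *
  have hn1 : 1 < n := by
    rcases hn.lt_or_eq with h | rfl
    · exact h
    · exact absurd (Subsingleton.elim _ _) hNr
  obtain ⟨hcb, hor⟩ := eq_Fl_or_eq_Fr_of_indistinguishable hn1 hs hnorm w kl harrow hnotind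
    hind.1 hind.2
  refine ⟨?_, ?_⟩
  · rcases hor with h | h
    · left
      rw [Ul, h, hcb, add_sub_cancel_right]
    · right
      left
      rw [Ur, h, hcb]
  · intro hsub heq
    have hcw := phi_ne w (kl + 1)
    have hNl : Nl s w ∈ ({phi w kl, phi w (kl + 1)} : Set (ZMod (n + 1))) := by
      rw [heq]
      simp
    have hNr' : Nr s w ∈ ({phi w kl, phi w (kl + 1)} : Set (ZMod (n + 1))) := by
      rw [heq]
      simp
    have hl : Arrow s (w - 1) w := by
      by_contra h
      rw [Nl, if_neg h] at hNl
      rcases hNl with e | e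
      · exact hblw e.symm
      · exact hcw e.symm
    have hr : Arrow s w (w + 1) := by
      by_contra h
      rw [Nr, if_neg h] at hNr'
      rcases hNr' with e | e
      · exact hblw e.symm
      · exact hcw e.symm
    rw [Nl, if_pos hl] at hNl
    rw [Nr, if_pos hr] at hNr'
    have hbc := (arrow_removePt_iff hs.1 w kl (kl + 1)).1 harrow
    have hb : phi w kl = w + 1 := by
      rcases hNr' with e | e
      · exact e.symm
      · exact absurd (add_right_cancel (hcb.symm.trans e.symm)) hblw
    have hc : phi w (kl + 1) = w - 1 := by
      rcases hNl with e | e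
      · refine absurd ?_ hcw
        rw [hcb, ← e, sub_add_cancel]
      · exact e.symm
    have h3 : ((3 : ℕ) : ZMod (n + 1)) = 0 := by
      push_cast
      linear_combination hc - hcb - hb
    have hn2 : n = 2 := by
      have := Nat.le_of_dvd (by norm_num) ((ZMod.natCast_eq_zero_iff _ _).1 h3)
      omega
    subst hn2
    have hpos : ∀ i j, Arrow s i j → 1 ≤ s i := fun i j ⟨m, h1, h2, _⟩ => h1.trans h2
    have hall : ∀ i, 1 ≤ s i := by
      intro i
      have hi : i = w ∨ i = w + 1 ∨ i = w - 1 := by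
        clear * -
        revert i w
        decide
      rcases hi with rfl | rfl | rfl
      · exact hpos _ _ hr
      · exact hpos _ _ (hb ▸ hbc)
      · exact hpos _ _ hl
    have huniv := isUniversalPt_of_three hall
    have hw1 : w + 1 ≠ w := by
      rw [← hb]
      exact hblw
    exact hw1 (hsub ⟨Or.inl (huniv w (w + 1) hw1), huniv _⟩ ⟨Or.inr rfl, huniv _⟩)
end
end

section
/- Let H be a finite PCA graph and let v be a vertex of H. Let S be the set of vertices w of H such that w ≠ v, w is not adjacent to v in H, and w is not universal in H ∖ {v} (i.e., w fails to be adjacent to some other vertex of H ∖ {v}). Then the vertices of S lie in at most two connected components of the complement of H ∖ {v}. -/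
open Classical

noncomputable section

/-- The displacement of `j` from `p`, walking forward around the circle. -/
def offset {n : ℕ} (p j : ZMod n) : ℕ := (j - p).val

/-- The unrolled right reach of the point at offset `a` from `p`. -/
def reach {n : ℕ} (r : ZMod n → ℕ) (p : ZMod n) (a : ℕ) : ℕ := a + r (p + a)

/-- Equality or adjacency of two points of the circle in unrolled coordinates, where `g` is
the reach function. -/
def Near (n : ℕ) (g : ℕ → ℕ) (a b : ℕ) : Prop :=
  (a ≤ b ∧ b ≤ g a) ∨ (b ≤ a ∧ a ≤ g b) ∨ b + n ≤ g a ∨ a + n ≤ g b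

lemma Near.symm {n : ℕ} {g : ℕ → ℕ} {a b : ℕ} (h : Near n g a b) : Near n g b a := by
  unfold Near at *
  tauto

lemma offset_lt {n : ℕ} [NeZero n] (p j : ZMod n) : offset p j < n := ZMod.val_lt _

lemma add_offset {n : ℕ} [NeZero n] (p j : ZMod n) : p + (offset p j : ZMod n) = j := by
  simp [offset]

lemma reach_monotone {n : ℕ} {r : ZMod n → ℕ} (hr : IsRoundRep n r) (p : ZMod n) :
    Monotone (reach r p) := by
  refine monotone_nat_of_le_succ fun a => ?_
  have h := hr.2 (p + a)
  have e : p + ((a + 1 : ℕ) : ZMod n) = p + a + 1 := by push_cast; ring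
  unfold reach
  rw [e]
  omega

lemma reach_period {n : ℕ} (r : ZMod n → ℕ) (p : ZMod n) :
    reach r p n = reach r p 0 + n := by
  simp [reach, add_comm]

lemma arrow_iff_offset {n : ℕ} [NeZero n] {r : ZMod n → ℕ} (hr : IsRoundRep n r)
    (p : ZMod n) {i j : ZMod n} (hij : i ≠ j) :
    Arrow r i j ↔ (offset p i ≤ offset p j ∧ offset p j ≤ reach r p (offset p i)) ∨
      offset p j + n ≤ reach r p (offset p i) := by
  have hi := add_offset p i
  have hj := add_offset p j
  have hin := offset_lt p i
  have hjn := offset_lt p j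
  have hne : offset p i ≠ offset p j := fun h => hij (by rw [← hi, ← hj, h])
  have hri := hr.1 i
  unfold reach
  rw [hi]
  generalize offset p i = a at *
  generalize offset p j = b at *
  constructor
  · rintro ⟨k, hk1, hk2, hk⟩
    have hmod : ((a + k : ℕ) : ZMod n) = (b : ℕ) := by
      push_cast
      have h : p + b = p + (a + k) := by rw [hj, hk, ← hi]; ring
      exact (add_left_cancel h).symm
    rw [ZMod.natCast_eq_natCast_iff] at hmod
    rcases Nat.lt_or_ge (a + k) n with h | h
    · rw [Nat.ModEq, Nat.mod_eq_of_lt h, Nat.mod_eq_of_lt hjn] at hmod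
      omega
    · rw [Nat.ModEq, Nat.mod_eq_sub_mod h, Nat.mod_eq_of_lt (by omega : a + k - n < n),
        Nat.mod_eq_of_lt hjn] at hmod
      omega
  · rintro (⟨h1, h2⟩ | h)
    · refine ⟨b - a, by omega, by omega, ?_⟩
      rw [← hi, ← hj, Nat.cast_sub h1]
      ring
    · refine ⟨b + n - a, by omega, by omega, ?_⟩
      rw [← hi, ← hj, Nat.cast_sub (by omega)]
      simp

lemma near_offset_iff {n : ℕ} [NeZero n] {r : ZMod n → ℕ} (hr : IsRoundRep n r)
    (p i j : ZMod n) :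
    (i = j ∨ (roundGraph r).Adj i j) ↔ Near n (reach r p) (offset p i) (offset p j) := by
  by_cases hij : i = j
  · subst hij
    simp [Near, reach]
  · rw [roundGraph, SimpleGraph.fromRel_adj, arrow_iff_offset hr p hij,
      arrow_iff_offset hr p (Ne.symm hij), Near]
    tauto

/-- A point near both ends of three ordered, pairwise near points, none of them near the
origin, is near the middle one. -/
lemma near_middle {n : ℕ} {g : ℕ → ℕ} (hg : Monotone g) (hgn : g n = g 0 + n)
    {x₁ x₂ x₃ y : ℕ} (hy : y < n) (h₁₂ : x₁ ≤ x₂) (h₂₃ : x₂ ≤ x₃)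
    (h₁ : ¬ Near n g 0 x₁) (h₂ : ¬ Near n g 0 x₂) (h₃ : ¬ Near n g 0 x₃)
    (n₁₂ : Near n g x₁ x₂) (n₂₃ : Near n g x₂ x₃)
    (y₁ : Near n g x₁ y) (y₃ : Near n g x₃ y) : Near n g x₂ y := by
  have m₁ := hg hy.le
  have m₂ := hg h₁₂
  have m₃ := hg h₂₃
  unfold Near at *
  omega

/-- Among three pairwise near points not near the origin, there are no three witnesses each
of which is near all of these points but its own. -/
lemma not_exists_three_private_nonneighbors {n : ℕ} {g : ℕ → ℕ} (hg : Monotone g)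
    (hgn : g n = g 0 + n) {x₁ x₂ x₃ y₁ y₂ y₃ : ℕ}
    (hy₁ : y₁ < n) (hy₂ : y₂ < n) (hy₃ : y₃ < n)
    (h₁ : ¬ Near n g 0 x₁) (h₂ : ¬ Near n g 0 x₂) (h₃ : ¬ Near n g 0 x₃)
    (n₁₂ : Near n g x₁ x₂) (n₁₃ : Near n g x₁ x₃) (n₂₃ : Near n g x₂ x₃)
    (a₁₂ : Near n g x₁ y₂) (a₁₃ : Near n g x₁ y₃) (a₂₁ : Near n g x₂ y₁)
    (a₂₃ : Near n g x₂ y₃) (a₃₁ : Near n g x₃ y₁) (a₃₂ : Near n g x₃ y₂)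
    (b₁ : ¬ Near n g x₁ y₁) (b₂ : ¬ Near n g x₂ y₂) (b₃ : ¬ Near n g x₃ y₃) : False := by
  rcases le_total x₁ x₂ with h12 | h12 <;> rcases le_total x₂ x₃ with h23 | h23 <;>
    rcases le_total x₁ x₃ with h13 | h13
  · exact b₂ (near_middle hg hgn hy₂ h12 h23 h₁ h₂ h₃ n₁₂ n₂₃ a₁₂ a₃₂)
  · exact b₂ (near_middle hg hgn hy₂ h12 h23 h₁ h₂ h₃ n₁₂ n₂₃ a₁₂ a₃₂)
  · exact b₃ (near_middle hg hgn hy₃ h13 h23 h₁ h₃ h₂ n₁₃ n₂₃.symm a₁₃ a₂₃)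
  · exact b₁ (near_middle hg hgn hy₁ h13 h12 h₃ h₁ h₂ n₁₃.symm n₁₂ a₃₁ a₂₁)
  · exact b₁ (near_middle hg hgn hy₁ h12 h13 h₂ h₁ h₃ n₁₂.symm n₁₃ a₂₁ a₃₁)
  · exact b₃ (near_middle hg hgn hy₃ h23 h13 h₂ h₃ h₁ n₂₃ n₁₃.symm a₂₃ a₁₃)
  · exact b₂ (near_middle hg hgn hy₂ h23 h12 h₃ h₂ h₁ n₂₃.symm n₁₂.symm a₃₂ a₁₂)
  · exact b₂ (near_middle hg hgn hy₂ h23 h12 h₃ h₂ h₁ n₂₃.symm n₁₂.symm a₃₂ a₁₂)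

lemma adj_of_compl_component_ne {V : Type*} {G : SimpleGraph V} {a b : V}
    (h : Gᶜ.connectedComponentMk a ≠ Gᶜ.connectedComponentMk b) : G.Adj a b := by
  by_contra hab
  have hne : a ≠ b := fun e => h (by rw [e])
  exact h (SimpleGraph.ConnectedComponent.sound
    ((G.compl_adj a b).2 ⟨hne, hab⟩).reachable)

lemma compl_component_eq {V : Type*} {G : SimpleGraph V} {a b : V} (hne : b ≠ a)
    (h : ¬ G.Adj a b) : Gᶜ.connectedComponentMk b = Gᶜ.connectedComponentMk a :=
  SimpleGraph.ConnectedComponent.sound ((G.compl_adj a b).2 ⟨hne.symm, h⟩).reachable.symm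

theorem stmt10 {V : Type*} [Fintype V] (H : SimpleGraph V) (hpca : IsPCA H) (v : V) :
    {C : ((H.induce {u : V | u ≠ v})ᶜ).ConnectedComponent |
        ∃ w : {u : V | u ≠ v},
          ¬ H.Adj v ↑w ∧
          (∃ u : {u : V | u ≠ v}, u ≠ w ∧ ¬ (H.induce {u : V | u ≠ v}).Adj w u) ∧
          ((H.induce {u : V | u ≠ v})ᶜ).connectedComponentMk w = C}.ncard ≤ 2 := by
  obtain ⟨n, hn, r, β, hr, -, -, hadj⟩ := hpca
  have : NeZero n := ⟨by omega⟩
  have key : ∀ a b : V, a ≠ b → (H.Adj a b ↔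
      Near n (reach r (β v)) (offset (β v) (β a)) (offset (β v) (β b))) := fun a b hab =>
    (hadj a b hab).trans (near_offset_iff hr _ _ _)
  have hv : offset (β v) (β v) = 0 := by simp [offset]
  by_contra hcard
  rw [not_le, Set.two_lt_ncard] at hcard
  obtain ⟨_, ⟨w₁, hw₁, ⟨u₁, hu₁, hn₁⟩, rfl⟩, _, ⟨w₂, hw₂, ⟨u₂, hu₂, hn₂⟩, rfl⟩,
    _, ⟨w₃, hw₃, ⟨u₃, hu₃, hn₃⟩, rfl⟩, h12, h13, h23⟩ := hcard
  have near_of_ne : ∀ a b : {u : V | u ≠ v},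
      ((H.induce {u : V | u ≠ v})ᶜ).connectedComponentMk a ≠
        ((H.induce {u : V | u ≠ v})ᶜ).connectedComponentMk b →
      Near n (reach r (β v)) (offset (β v) (β a)) (offset (β v) (β b)) := fun a b h => by
    have hab := adj_of_compl_component_ne h
    exact (key a b (fun e => hab.ne (Subtype.ext e))).1 hab
  have not_near_v : ∀ w : {u : V | u ≠ v}, ¬ H.Adj v w →
      ¬ Near n (reach r (β v)) 0 (offset (β v) (β w)) := fun w h h' =>
    h ((key v w (Ne.symm w.2)).2 (by rwa [hv]))
  have not_near : ∀ w u : {u : V | u ≠ v}, u ≠ w →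
      ¬ (H.induce {u : V | u ≠ v}).Adj w u →
      ¬ Near n (reach r (β v)) (offset (β v) (β w)) (offset (β v) (β u)) :=
    fun w u hne h h' => h ((key w u (fun e => hne (Subtype.ext e.symm))).2 h')
  have c₁ := compl_component_eq hu₁ hn₁
  have c₂ := compl_component_eq hu₂ hn₂
  have c₃ := compl_component_eq hu₃ hn₃
  exact not_exists_three_private_nonneighbors (reach_monotone hr (β v)) (reach_period r (β v))
    (offset_lt _ _) (offset_lt _ _) (offset_lt _ _)
    (not_near_v _ hw₁) (not_near_v _ hw₂) (not_near_v _ hw₃)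
    (near_of_ne _ _ h12) (near_of_ne _ _ h13) (near_of_ne _ _ h23)
    (near_of_ne w₁ u₂ (c₂ ▸ h12)) (near_of_ne w₁ u₃ (c₃ ▸ h13))
    (near_of_ne w₂ u₁ (c₁ ▸ h12.symm)) (near_of_ne w₂ u₃ (c₃ ▸ h23))
    (near_of_ne w₃ u₁ (c₁ ▸ h13.symm)) (near_of_ne w₃ u₂ (c₂ ▸ h23.symm))
    (not_near _ _ hu₁ hn₁) (not_near _ _ hu₂ hn₂) (not_near _ _ hu₃ hn₃)
end
end

section
/- Let n ≥ 1, let r be a normal round representation on ZMod n such that 𝒢(r) is connected, the complement of 𝒢(r) is bipartite, and 𝒢(r) is not a PIG graph. Let H be a simple graph on Option (ZMod n) whose restriction to the points some i coincides with 𝒢(r) (i.e., H has the edge (some i)(some j) iff 𝒢(r) has the edge ij), and assume H is a PCA graph. Let D be the vertex set of a connected component of the complement of 𝒢(r), let x ∈ D, and define X_0 = {x} and X_{k+1} = N̄(N̄(X_k)) for k ≥ 0, where N̄ is taken in 𝒢(r). If p is the least natural number with X_{p+1} = X_p, then p ≤ |{j ∈ D : H has the edge (none)(some j)}| + 2. 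-/
open Classical

noncomputable section

/-- Reading positions clockwise from a point `v` that `i` does not dominate, the points dominated
by `i` are exactly those in a bounded range after `i`. -/
lemma arrow_iff_val_sub {N : ℕ} [NeZero N] {r : ZMod N → ℕ} {v i : ZMod N} (hiv : ¬ Arrow r i v)
    (j : ZMod N) :
    Arrow r i j ↔ (i - v).val < (j - v).val ∧ (j - v).val ≤ (i - v).val + r i := by
  have hlt : (i - v).val + r i < N := by
    by_contra! hge
    have hi := ZMod.val_lt (i - v)
    refine hiv ⟨N - (i - v).val, by omega, by omega, ?_⟩
    rw [Nat.cast_sub hi.le, ZMod.natCast_self, ZMod.natCast_zmod_val]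
    ring
  constructor
  · rintro ⟨k, hk1, hk, rfl⟩
    have hkv : ((k : ZMod N)).val = k := ZMod.val_cast_of_lt (by omega)
    have h : (i + (k : ZMod N) - v).val = (i - v).val + k := by
      rw [add_sub_right_comm, ZMod.val_add_of_lt (by rw [hkv]; omega), hkv]
    omega
  · rintro ⟨h1, h2⟩
    refine ⟨(j - v).val - (i - v).val, by omega, by omega, ?_⟩
    rw [Nat.cast_sub h1.le, ZMod.natCast_zmod_val, ZMod.natCast_zmod_val]
    ring

lemma roundGraph_adj_iff {N : ℕ} {r : ZMod N → ℕ} {i j : ZMod N} :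
    (roundGraph r).Adj i j ↔ i ≠ j ∧ (Arrow r i j ∨ Arrow r j i) :=
  SimpleGraph.fromRel_adj _ _ _

/-- A PCA graph has no induced disjoint union of a four-cycle and an isolated vertex. -/
lemma IsPCA.not_four_cycle_union_isolated {V : Type*} {H : SimpleGraph V} (hH : IsPCA H)
    {v a b c d : V} (ha : a ≠ v ∧ ¬ H.Adj a v) (hb : b ≠ v ∧ ¬ H.Adj b v)
    (hc : c ≠ v ∧ ¬ H.Adj c v) (hd : d ≠ v ∧ ¬ H.Adj d v)
    (hab : a ≠ b ∧ ¬ H.Adj a b) (hcd : c ≠ d ∧ ¬ H.Adj c d)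
    (hac : H.Adj a c) (had : H.Adj a d) (hbc : H.Adj b c) (hbd : H.Adj b d) : False := by
  obtain ⟨N, hN, r, β, -, -, -, hβ⟩ := hH
  have : NeZero N := ⟨by omega⟩
  set s : V → ℕ := fun u => (β u - β v).val with hs
  have hinj : ∀ u w, s u = s w ↔ β u = β w := fun u w => by
    simp only [hs, (ZMod.val_injective N).eq_iff, sub_left_inj]
  have harrow : ∀ u, u ≠ v ∧ ¬ H.Adj u v → ∀ w,
      (Arrow r (β u) (β w) ↔ s u < s w ∧ s w ≤ s u + r (β u)) := fun u hu w => by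
    refine arrow_iff_val_sub (fun h => ?_) _
    rw [hβ u v hu.1, roundGraph_adj_iff] at hu
    tauto
  have hadj : ∀ u w, u ≠ v ∧ ¬ H.Adj u v → w ≠ v ∧ ¬ H.Adj w v → u ≠ w →
      (H.Adj u w ↔ s u = s w ∨ (s u < s w ∧ s w ≤ s u + r (β u)) ∨
        (s w < s u ∧ s u ≤ s w + r (β w))) := fun u w hu hw huw => by
    rw [hβ u w huw, roundGraph_adj_iff, harrow u hu, harrow w hw, hinj]
    tauto
  have h1 := (hadj a b ha hb hab.1).not.1 hab.2
  have h2 := (hadj c d hc hd hcd.1).not.1 hcd.2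
  have h3 := (hadj a c ha hc hac.ne).1 hac
  have h4 := (hadj a d ha hd had.ne).1 had
  have h5 := (hadj b c hb hc hbc.ne).1 hbc
  have h6 := (hadj b d hb hd hbd.ne).1 hbd
  have e : ∀ u w, s u = s w → r (β u) = r (β w) := fun u w h => by rw [(hinj u w).1 h]
  have := e a c
  have := e a d
  have := e b c
  have := e b d
  omega

lemma mem_coNbhdSet {V : Type*} {G : SimpleGraph V} {S : Set V} {w : V} :
    w ∈ coNbhdSet G S ↔ ∃ u ∈ S, Gᶜ.Adj u w := by
  simp [coNbhdSet, coNbhd, SimpleGraph.compl_adj, eq_comm, and_left_comm]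

/-- Iterating `N̄ ∘ N̄` collects the endpoints of the walks of even length in the complement. -/
lemma mem_iterate_coNbhdSet_iff {V : Type*} {G : SimpleGraph V} {x : V} {X : ℕ → Set V}
    (hX0 : X 0 = {x}) (hXs : ∀ k, X (k + 1) = coNbhdSet G (coNbhdSet G (X k))) (k : ℕ) (w : V) :
    w ∈ X k ↔ ∃ q : Gᶜ.Walk x w, q.length = 2 * k := by
  induction k generalizing w with
  | zero =>
    rw [hX0, Set.mem_singleton_iff]
    constructor
    · rintro rfl
      exact ⟨.nil, rfl⟩
    · rintro ⟨q, hq⟩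
      exact (SimpleGraph.Walk.eq_of_length_eq_zero hq).symm
  | succ k ih =>
    rw [hXs, mem_coNbhdSet]
    simp only [mem_coNbhdSet, ih]
    constructor
    · rintro ⟨u, ⟨t, ⟨q, hq⟩, htu⟩, huw⟩
      exact ⟨(q.concat htu).concat huw, by simp [hq]; ring⟩
    · rintro ⟨q, hq⟩
      refine ⟨q.getVert (2 * k + 1), ⟨q.getVert (2 * k), ⟨q.take (2 * k), ?_⟩, ?_⟩, ?_⟩
      · rw [SimpleGraph.Walk.take_length]; omega
      · exact q.adj_getVert_succ (by omega)
      · have := q.adj_getVert_succ (i := 2 * k + 1) (by omega)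
        rwa [show 2 * k + 1 + 1 = q.length by omega, q.getVert_length] at this

lemma walk_length_even_iff {V : Type*} {G : SimpleGraph V} {S : Set V}
    (hS : ∀ v w, G.Adj v w → (v ∈ S ↔ w ∉ S)) {u w : V} (q : G.Walk u w) :
    Even q.length ↔ (u ∈ S ↔ w ∈ S) := by
  induction q with
  | nil => simp
  | cons h q ih =>
    have := hS _ _ h
    rw [SimpleGraph.Walk.length_cons, Nat.even_add_one, ih]
    tauto

lemma dist_getVert_of_length_eq_dist {V : Type*} {G : SimpleGraph V} {u w : V} {q : G.Walk u w}
    (hq : q.length = G.dist u w) {i : ℕ} (hi : i ≤ q.length) : G.dist u (q.getVert i) = i := by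
  have h1 := SimpleGraph.dist_le (q.take i)
  rw [SimpleGraph.Walk.take_length] at h1
  obtain ⟨t, ht⟩ := (q.take i).reachable.exists_walk_length_eq_dist
  have h2 := SimpleGraph.dist_le (t.append (q.drop i))
  rw [SimpleGraph.Walk.length_append, SimpleGraph.Walk.drop_length] at h2
  omega

/-- A set missing few of the vertices of a long sequence leaves two far apart consecutive pairs. -/
lemma exists_two_far_consecutive_pairs {V : Type*} {B : Set V} (hB : B.Finite) {L : ℕ} {y : ℕ → V}
    (hy : Set.InjOn y (Set.Iic L)) (hL : 2 * B.ncard + 4 ≤ L) :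
    ∃ i j, i + 3 ≤ j ∧ j < L ∧ y i ∉ B ∧ y (i + 1) ∉ B ∧ y j ∉ B ∧ y (j + 1) ∉ B := by
  set I := (Finset.range (L + 1)).filter (fun i => y i ∈ B) with hI
  have hIcard : I.card ≤ B.ncard := by
    rw [← Set.ncard_coe_finset]
    refine Set.ncard_le_ncard_of_injOn y (fun i hi => ?_) (hy.mono fun i hi => ?_) hB
    · exact (Finset.mem_filter.1 hi).2
    · have := Finset.mem_range.1 (Finset.mem_filter.1 hi).1
      exact Set.mem_Iic.2 (by omega)
  set E := (Finset.range L).filter (fun i => y i ∉ B ∧ y (i + 1) ∉ B) with hE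
  have hcover : Finset.range L ⊆ E ∪ (I ∪ I.image (· - 1)) := by
    intro i hi
    have hi' := Finset.mem_range.1 hi
    simp only [Finset.mem_union, hE, hI, Finset.mem_filter, Finset.mem_range, Finset.mem_image]
    by_cases h1 : y i ∈ B
    · exact Or.inr (Or.inl ⟨by omega, h1⟩)
    by_cases h2 : y (i + 1) ∈ B
    · exact Or.inr (Or.inr ⟨i + 1, ⟨by omega, h2⟩, by omega⟩)
    exact Or.inl ⟨hi', h1, h2⟩
  have hcard := Finset.card_le_card hcover
  have hu1 := Finset.card_union_le E (I ∪ I.image (· - 1))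
  have hu2 := Finset.card_union_le I (I.image (· - 1))
  have hu3 := Finset.card_image_le (s := I) (f := (· - 1))
  rw [Finset.card_range] at hcard
  have hne : E.Nonempty := Finset.card_pos.1 (by omega)
  have hmin := (Finset.mem_filter.1 (E.min'_mem hne))
  by_contra! hno
  have hsub : E ⊆ Finset.Ico (E.min' hne) (E.min' hne + 3) := by
    intro j hj
    have hj' := Finset.mem_filter.1 hj
    rw [Finset.mem_Ico]
    refine ⟨E.min'_le j hj, ?_⟩
    by_contra! hlt
    exact hj'.2.2 (hno _ j hlt (Finset.mem_range.1 hj'.1) hmin.2.1 hmin.2.2 hj'.2.1)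
  have := Finset.card_le_card hsub
  rw [Nat.card_Ico] at this
  omega

theorem stmt11 {n : ℕ} (hn : 1 ≤ n) (r : ZMod n → ℕ)
    (hr : IsRoundRep n r) (hnorm : IsNormal r)
    (hconn : (roundGraph r).Connected)
    (hbip : IsBipartite ((roundGraph r)ᶜ))
    (hnpig : ¬ IsPIG (roundGraph r))
    (H : SimpleGraph (Option (ZMod n)))
    (hH : ∀ i j : ZMod n, H.Adj (some i) (some j) ↔ (roundGraph r).Adj i j)
    (hHpca : IsPCA H)
    (C : ((roundGraph r)ᶜ).ConnectedComponent) (x : ZMod n) (hx : x ∈ C.supp)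
    (X : ℕ → Set (ZMod n)) (hX0 : X 0 = {x})
    (hXs : ∀ k, X (k + 1) = coNbhdSet (roundGraph r) (coNbhdSet (roundGraph r) (X k)))
    (p : ℕ) (hp : X (p + 1) = X p) (hpmin : ∀ q < p, X (q + 1) ≠ X q) :
    p ≤ {j : ZMod n | j ∈ C.supp ∧ H.Adj none (some j)}.ncard + 2 := by
  have : NeZero n := ⟨by omega⟩
  by_contra! hlt
  set B := {j : ZMod n | j ∈ C.supp ∧ H.Adj none (some j)} with hB
  have hmem := mem_iterate_coNbhdSet_iff hX0 hXs
  obtain ⟨S, hS⟩ := hbip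
  obtain ⟨u, hxu⟩ : ∃ u, (roundGraph r)ᶜ.Adj x u := by
    by_contra! hno
    have h1 : X 1 = ∅ := by
      rw [hXs, hX0]
      ext w
      simp [mem_coNbhdSet, -SimpleGraph.compl_adj, hno]
    refine hpmin 1 (by omega) ?_
    rw [hXs, h1]
    ext w
    simp [mem_coNbhdSet]
  have hmono : Monotone X := monotone_nat_of_le_succ fun k w hw => by
    obtain ⟨q, hq⟩ := (hmem k w).1 hw
    exact (hmem (k + 1) w).2 ⟨.cons hxu (.cons hxu.symm q), by simp [hq]; ring⟩
  obtain ⟨z, hz, hz'⟩ : ∃ z ∈ X p, z ∉ X (p - 1) := by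
    by_contra! hsub
    refine hpmin (p - 1) (by omega) (subset_antisymm ?_ (hmono (by omega)))
    rw [show p - 1 + 1 = p by omega]
    exact hsub
  obtain ⟨t, ht⟩ := (hmem p z).1 hz
  obtain ⟨q, hq⟩ := t.reachable.exists_walk_length_eq_dist
  have hqlen : q.length = 2 * p := by
    have hle := SimpleGraph.dist_le t
    obtain ⟨k, hk⟩ : Even q.length := by
      rw [walk_length_even_iff hS, ← walk_length_even_iff hS t, ht]
      exact even_two_mul p
    by_contra hne
    exact hz' (hmono (by omega : k ≤ p - 1) ((hmem k z).2 ⟨q, by omega⟩))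
  have hdist : ∀ i ≤ 2 * p, (roundGraph r)ᶜ.dist x (q.getVert i) = i := fun i hi =>
    dist_getVert_of_length_eq_dist hq (by omega)
  have hadj : ∀ i < 2 * p, (roundGraph r)ᶜ.Adj (q.getVert i) (q.getVert (i + 1)) := fun i hi =>
    q.adj_getVert_succ (by omega)
  have hinj : Set.InjOn q.getVert (Set.Iic (2 * p)) := fun i hi j hj hij => by
    rw [← hdist i hi, ← hdist j hj, hij]
  have hfar : ∀ i j, i + 2 ≤ j → j ≤ 2 * p →
      H.Adj (some (q.getVert i)) (some (q.getVert j)) := fun i j hij hj => by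
    rw [hH]
    by_contra hna
    have hne : q.getVert i ≠ q.getVert j := fun h => by
      have := hinj (Set.mem_Iic.2 (by omega)) (Set.mem_Iic.2 hj) h
      omega
    have hc : (roundGraph r)ᶜ.Adj (q.getVert i) (q.getVert j) :=
      (SimpleGraph.compl_adj _ _ _).2 ⟨hne, hna⟩
    have := SimpleGraph.dist_le ((q.take i).concat hc)
    rw [SimpleGraph.Walk.length_concat, SimpleGraph.Walk.take_length, hdist j hj] at this
    omega
  have hnear : ∀ i < 2 * p, some (q.getVert i) ≠ some (q.getVert (i + 1)) ∧
      ¬ H.Adj (some (q.getVert i)) (some (q.getVert (i + 1))) := fun i hi => by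
    rw [hH, Ne, Option.some_inj]
    exact (SimpleGraph.compl_adj _ _ _).1 (hadj i hi)
  have hnone : ∀ i, q.getVert i ∉ B →
      some (q.getVert i) ≠ none ∧ ¬ H.Adj (some (q.getVert i)) none := fun i hi =>
    ⟨Option.some_ne_none _, fun h => hi
      ⟨(SimpleGraph.ConnectedComponent.sound (q.take i).reachable.symm).trans hx, h.symm⟩⟩
  obtain ⟨i, j, hij, hj, h1, h2, h3, h4⟩ :=
    exists_two_far_consecutive_pairs B.toFinite hinj (by omega)
  exact hHpca.not_four_cycle_union_isolated (hnone _ h1) (hnone _ h2) (hnone _ h3) (hnone _ h4)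
    (hnear i (by omega)) (hnear j hj) (hfar _ _ (by omega) (by omega))
    (hfar _ _ (by omega) (by omega)) (hfar _ _ (by omega) (by omega))
    (hfar _ _ (by omega) (by omega))
end
end

section
/- Let G be a finite simple graph with a round representation (r, β) on ZMod n such that 𝒢(r) is connected, and let a ≠ b be points forming a connectable pair ⟨a, b⟩ (i.e., b = U_r a and a = U_l b; in particular a and b are non-adjacent in 𝒢(r)). Let B_l ⊆ β⁻¹(a) and B_r ⊆ β⁻¹(b). Then the graph obtained from G by adding every edge vw with v ∈ B_l and w ∈ B_r is a PCA graph. -/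
open Classical

noncomputable section

/-- A round representation cut open at a base point: the points are `0, …, n - 1`, and `e x` is the
right far neighbor of `x` on the universal cover, so it may exceed `n`. The vertex map `β` is not
required to be surjective. -/
structure IsCutRep {V : Type*} (G : SimpleGraph V) (n : ℕ) (e : ℕ → ℕ) (β : V → ℕ) : Prop where
  lt : ∀ v, β v < n
  le_end : ∀ x < n, x ≤ e x
  end_lt : ∀ x < n, e x < x + n
  mono : ∀ x, x + 1 < n → e x ≤ e (x + 1)
  wrap : e (n - 1) ≤ e 0 + n
  normal : ∀ x y, x < y → y < n → y ≤ e x → e y < x + n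
  adj : ∀ u v, u ≠ v → β u ≤ β v → (G.Adj u v ↔ (β v ≤ e (β u) ∨ β u + n ≤ e (β v)))

theorem arrow_add_iff {n : ℕ} {r : ZMod n → ℕ} {i : ZMod n} (hi : r i < n) {k : ℕ} (hk : 1 ≤ k)
    (hkn : k < n) : Arrow r i (i + (k : ZMod n)) ↔ k ≤ r i := by
  constructor
  · rintro ⟨l, -, hl, h⟩
    rw [add_right_inj, ZMod.natCast_eq_natCast_iff'] at h
    rw [Nat.mod_eq_of_lt hkn, Nat.mod_eq_of_lt (by omega)] at h
    omega
  · intro h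
    exact ⟨k, hk, h, rfl⟩

theorem arrow_forward_iff {n : ℕ} {r : ZMod n → ℕ} (hr : ∀ i, r i < n) (p : ZMod n) {x y : ℕ}
    (hxy : x < y) (hy : y < n) :
    Arrow r (p + (x : ZMod n)) (p + (y : ZMod n)) ↔ y ≤ x + r (p + (x : ZMod n)) := by
  have h : p + (y : ZMod n) = p + (x : ZMod n) + ((y - x : ℕ) : ZMod n) := by
    rw [Nat.cast_sub hxy.le]; ring
  rw [h, arrow_add_iff (hr _) (by omega) (by omega)]
  omega

theorem arrow_backward_iff {n : ℕ} {r : ZMod n → ℕ} (hr : ∀ i, r i < n) (p : ZMod n) {x y : ℕ}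
    (hxy : x < y) (hy : y < n) :
    Arrow r (p + (y : ZMod n)) (p + (x : ZMod n)) ↔ x + n ≤ y + r (p + (y : ZMod n)) := by
  have h : p + (x : ZMod n) = p + (y : ZMod n) + ((x + n - y : ℕ) : ZMod n) := by
    rw [Nat.cast_sub (by omega)]; push_cast; rw [ZMod.natCast_self]; ring
  rw [h, arrow_add_iff (hr _) (by omega) (by omega)]
  omega

theorem add_natCast_val_sub {n : ℕ} [NeZero n] (p i : ZMod n) :
    p + (((i - p).val : ℕ) : ZMod n) = i := by
  rw [ZMod.natCast_zmod_val]; ring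

theorem add_natCast_ne {n : ℕ} (p : ZMod n) {x y : ℕ} (hxy : x < y) (hy : y < n) :
    p + (x : ZMod n) ≠ p + (y : ZMod n) := by
  rw [Ne, add_right_inj, ZMod.natCast_eq_natCast_iff', Nat.mod_eq_of_lt hy,
    Nat.mod_eq_of_lt (by omega)]
  omega

theorem roundGraph_adj_iff_s13 {n : ℕ} {r : ZMod n → ℕ} (hr : ∀ i, r i < n) (p : ZMod n) {x y : ℕ}
    (hxy : x < y) (hy : y < n) :
    (roundGraph r).Adj (p + (x : ZMod n)) (p + (y : ZMod n)) ↔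
      (y ≤ x + r (p + (x : ZMod n)) ∨ x + n ≤ y + r (p + (y : ZMod n))) := by
  rw [roundGraph, SimpleGraph.fromRel_adj, arrow_forward_iff hr p hxy hy,
    arrow_backward_iff hr p hxy hy]
  simp [add_natCast_ne p hxy hy]

theorem IsRoundRepOf.isCutRep {V : Type*} {G : SimpleGraph V} {n : ℕ} [NeZero n] {r : ZMod n → ℕ}
    {β : V → ZMod n} (h : IsRoundRepOf G n r β) (p : ZMod n) :
    IsCutRep G n (fun x => x + r (p + (x : ZMod n))) (fun v => (β v - p).val) := by
  obtain ⟨⟨hlt, hround⟩, hnormal, -, hadj⟩ := h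
  have hn : 0 < n := NeZero.pos n
  refine ⟨fun v => ZMod.val_lt _, fun x _ => by simp, fun x _ => by simp [hlt], ?_, ?_, ?_, ?_⟩
  · intro x _
    have := hround (p + (x : ZMod n))
    push_cast
    rw [← add_assoc]
    omega
  · have := hround (p + ((n - 1 : ℕ) : ZMod n))
    have hz : p + ((n - 1 : ℕ) : ZMod n) + 1 = p + ((0 : ℕ) : ZMod n) := by
      rw [Nat.cast_sub hn, ZMod.natCast_self]; push_cast; ring
    rw [hz] at this
    omega
  · intro x y hxy hy h1
    by_contra! h2
    exact hnormal _ _ (add_natCast_ne p hxy hy)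
      ⟨(arrow_forward_iff hlt p hxy hy).2 h1, (arrow_backward_iff hlt p hxy hy).2 h2⟩
  · intro u v huv hle
    rw [hadj u v huv]
    rcases hle.eq_or_lt with heq | hlt'
    · have : β u = β v := by simpa using ZMod.val_injective n heq
      simp [this]
    · have key := roundGraph_adj_iff_s13 hlt p hlt' (ZMod.val_lt _)
      have hne := add_natCast_ne p hlt' (ZMod.val_lt _)
      rw [add_natCast_val_sub, add_natCast_val_sub] at key hne
      simp only [add_natCast_val_sub, key, hne, false_or]

theorem IsCutRep.isPCA_of_surjOn {V : Type*} {G : SimpleGraph V} {n : ℕ} {e : ℕ → ℕ} {β : V → ℕ}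
    (h : IsCutRep G n e β) (hn : 1 ≤ n) (hsurj : ∀ x < n, ∃ v, β v = x) : IsPCA G := by
  have : NeZero n := ⟨by omega⟩
  set r : ZMod n → ℕ := fun i => e i.val - i.val with hr
  have hval : ∀ x < n, ((x : ℕ) : ZMod n).val = x := fun x hx => ZMod.val_cast_of_lt hx
  have hrx : ∀ x < n, x + r (0 + (x : ZMod n)) = e x := by
    intro x hx
    have := h.le_end x hx
    simp only [hr, zero_add, hval x hx]
    omega
  have hlt : ∀ i, r i < n := by
    intro i
    have := h.end_lt _ (ZMod.val_lt i)
    have := h.le_end _ (ZMod.val_lt i)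
    simp only [hr]
    omega
  have hnormal : ∀ x y, x < y → y < n →
      ¬(Arrow r (0 + (x : ZMod n)) (0 + (y : ZMod n)) ∧
        Arrow r (0 + (y : ZMod n)) (0 + (x : ZMod n))) := by
    rintro x y hxy hy ⟨h1, h2⟩
    rw [arrow_forward_iff hlt 0 hxy hy, hrx _ (hxy.trans hy)] at h1
    rw [arrow_backward_iff hlt 0 hxy hy, hrx _ hy] at h2
    have := h.normal x y hxy hy h1
    omega
  have hadj : ∀ u v, u ≠ v → β u ≤ β v → (G.Adj u v ↔ ((β u : ZMod n) = (β v : ZMod n) ∨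
      (roundGraph r).Adj (β u : ZMod n) (β v : ZMod n))) := by
    intro u v huv hle
    rw [h.adj u v huv hle]
    rcases hle.eq_or_lt with heq | hlt'
    · simp [heq, h.le_end _ (h.lt v)]
    · have key := roundGraph_adj_iff_s13 hlt 0 hlt' (h.lt v)
      have hne := add_natCast_ne (0 : ZMod n) hlt' (h.lt v)
      rw [hrx _ (h.lt u), hrx _ (h.lt v)] at key
      rw [zero_add, zero_add] at key hne
      simp [key, hne]
  refine ⟨n, hn, r, fun v => (β v : ZMod n), ⟨hlt, ?_⟩, ?_, ?_, ?_⟩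
  · intro i
    have hi := ZMod.val_lt i
    simp only [hr]
    have hi1 : (i + 1).val = (i.val + 1) % n := by
      conv_lhs => rw [← ZMod.natCast_zmod_val i]
      rw [← Nat.cast_succ, ZMod.val_natCast]
    rw [hi1]
    by_cases hw : i.val + 1 < n
    · rw [Nat.mod_eq_of_lt hw]
      have := h.mono _ hw
      omega
    · have hw' : i.val + 1 = n := by omega
      rw [hw', Nat.mod_self]
      have := h.wrap
      rw [show i.val = n - 1 by omega]
      omega
  · intro i j hij
    rw [← ZMod.natCast_zmod_val i, ← ZMod.natCast_zmod_val j, ← zero_add (i.val : ZMod n),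
      ← zero_add (j.val : ZMod n)]
    rcases lt_trichotomy i.val j.val with hlt' | heq | hgt
    · exact hnormal _ _ hlt' (ZMod.val_lt j)
    · exact absurd (ZMod.val_injective n heq) hij
    · rw [and_comm]
      exact hnormal _ _ hgt (ZMod.val_lt i)
  · intro i
    obtain ⟨v, hv⟩ := hsurj i.val (ZMod.val_lt i)
    exact ⟨v, by simp [hv]⟩
  · intro u v huv
    rcases le_total (β u) (β v) with hle | hle
    · exact hadj u v huv hle
    · rw [G.adj_comm, SimpleGraph.adj_comm (roundGraph r), eq_comm]
      exact hadj v u huv.symm hle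

theorem IsCutRep.exists_delete {V : Type*} {G : SimpleGraph V} {n : ℕ} {e : ℕ → ℕ} {β : V → ℕ}
    (h : IsCutRep G (n + 1) e β) (hn : 1 ≤ n) {q : ℕ} (hq : q < n + 1) (hβ : ∀ v, β v ≠ q) :
    ∃ (e' : ℕ → ℕ) (β' : V → ℕ), IsCutRep G n e' β' := by
  set δ : ℕ → ℕ := fun x => if x < q then x else x + 1 with hδ
  set σ : ℕ → ℕ := fun z => if z < q then z else if z < q + (n + 1) then z - 1 else z - 2 with hσ
  have hδlt : ∀ x < n, δ x < n + 1 := by intro x hx; simp only [hδ]; split_ifs <;> omega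
  have hδβ : ∀ v, δ (σ (β v)) = β v := by
    intro v
    have := h.lt v
    have := hβ v
    simp only [hδ, hσ]; grind
  have hσβ : ∀ v, σ (β v) < n := by
    intro v
    have := h.lt v
    have := hβ v
    simp only [hσ]; grind
  have hmono : ∀ y z, y ≤ z → σ y ≤ σ z := by
    intro y z hyz
    simp only [hσ]; split_ifs <;> omega
  have hσadd : ∀ z, z < q + (n + 1) → σ (z + (n + 1)) ≤ σ z + n := by
    intro z hz
    simp only [hσ]; split_ifs <;> omega
  have hfwd : ∀ y z, y < n → (q = 0 → 0 < z) → (y ≤ σ z ↔ δ y ≤ z) := by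
    intro y z hy hz
    simp only [hδ, hσ]; split_ifs <;> omega
  have hbwd : ∀ x z, x < n → (x + n ≤ σ z ↔ δ x + (n + 1) ≤ z) := by
    intro x z hx
    simp only [hδ, hσ]; split_ifs <;> omega
  have hδmono : ∀ x y, x < y → δ x < δ y := by
    intro x y hxy
    simp only [hδ]; split_ifs <;> omega
  have hemono : ∀ x y, x ≤ y → y < n + 1 → e x ≤ e y := by
    intro x y hxy
    induction y, hxy using Nat.le_induction with
    | base => intro _; exact le_rfl
    | succ y _ ih => intro hy; exact (ih (by omega)).trans (h.mono y hy)
  have hpos : ∀ x < n, q = 0 → 0 < e (δ x) := by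
    intro x hx hq0
    have := h.le_end _ (hδlt x hx)
    simp only [hδ, hq0] at this ⊢
    grind
  refine ⟨fun x => σ (e (δ x)), fun v => σ (β v), hσβ, ?_, ?_, ?_, ?_, ?_, ?_⟩
  · intro x hx
    rw [hfwd _ _ hx (hpos x hx)]
    exact h.le_end _ (hδlt x hx)
  · intro x hx
    have := h.end_lt _ (hδlt x hx)
    have := hbwd x (e (δ x)) hx
    omega
  · intro x hx
    exact hmono _ _ (hemono _ _ (hδmono _ _ (Nat.lt_succ_self x)).le (hδlt _ hx))
  · have h1 : e (δ (n - 1)) ≤ e (δ 0) + (n + 1) := by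
      have h1 := hemono (δ (n - 1)) n (Nat.lt_succ_iff.1 (hδlt _ (by omega))) (by omega)
      have h2 := hemono 0 (δ 0) (Nat.zero_le _) (hδlt _ (by omega))
      have h3 := h.wrap
      rw [Nat.add_sub_cancel] at h3
      omega
    have h2 := hmono _ _ h1
    rcases lt_or_ge (e (δ 0)) (q + (n + 1)) with h3 | h3
    · exact h2.trans (hσadd _ h3)
    · have h4 := hmono _ _ h3
      have h5 : σ (q + (n + 1)) = q + n - 1 := by simp [hσ]; omega
      have h6 := h.end_lt _ (hδlt (n - 1) (by omega))
      have h7 := hbwd (n - 1) (e (δ (n - 1))) (by omega)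
      omega
  · intro x y hxy hy hle
    have h1 := h.normal _ _ (hδmono _ _ hxy) (hδlt _ hy) ((hfwd _ _ hy (hpos x (hxy.trans hy))).1 hle)
    have := hbwd x (e (δ y)) (hxy.trans hy)
    omega
  · intro u v huv hle
    have hle' : β u ≤ β v := by
      by_contra! hlt
      rcases hle.eq_or_lt with heq | hlt'
      · have h1 := hδβ u
        rw [heq, hδβ v] at h1
        omega
      · have := hδmono _ _ hlt'
        rw [hδβ, hδβ] at this
        omega
    rw [h.adj u v huv hle', hfwd _ _ (hσβ v) (hpos _ (hσβ u)), hbwd _ _ (hσβ u), hδβ, hδβ]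

theorem IsCutRep.isPCA {V : Type*} [Nonempty V] {G : SimpleGraph V} {n : ℕ} {e : ℕ → ℕ} {β : V → ℕ}
    (h : IsCutRep G n e β) : IsPCA G := by
  induction n generalizing e β with
  | zero => exact absurd (h.lt (Classical.arbitrary V)) (Nat.not_lt_zero _)
  | succ n ih =>
    by_cases hsurj : ∀ x < n + 1, ∃ v, β v = x
    · exact h.isPCA_of_surjOn (by omega) hsurj
    · push Not at hsurj
      obtain ⟨q, hq, hβ⟩ := hsurj
      have := h.lt (Classical.arbitrary V)
      have := hβ (Classical.arbitrary V)
      obtain ⟨e', β', h'⟩ := h.exists_delete (by omega) hq hβ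
      exact ih h'

/-- Double every point and let the upper copy of `0` reach the lower copy of `e 0 + 1`. -/
theorem IsCutRep.isPCA_sup {V : Type*} [Nonempty V] {G : SimpleGraph V} {n : ℕ} {e : ℕ → ℕ}
    {β : V → ℕ} (h : IsCutRep G n e β) (hb : e 0 + 1 < n) (he : e 0 < e 1)
    (hnot : e (e 0 + 1) < n) (Bl Br : Set V) (hBl : ∀ v ∈ Bl, β v = 0)
    (hBr : ∀ v ∈ Br, β v = e 0 + 1) :
    IsPCA (G ⊔ SimpleGraph.fromRel (fun v w => v ∈ Bl ∧ w ∈ Br)) := by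
  set e' : ℕ → ℕ := fun z => if z = 1 then 2 * e 0 + 2 else 2 * e (z / 2) + 1 with he'
  set β' : V → ℕ := fun v =>
    if v ∈ Bl ∨ (β v = e 0 + 1 ∧ v ∉ Br) then 2 * β v + 1 else 2 * β v with hβ'
  have hhalf : ∀ v, β' v / 2 = β v := by
    intro v
    simp only [hβ']
    split_ifs <;> omega
  have hl : ∀ v, β' v = 1 ↔ v ∈ Bl := by
    intro v
    have := hBl v
    simp only [hβ']
    grind
  have hr : ∀ v, β' v = 2 * (e 0 + 1) ↔ v ∈ Br := by
    intro v
    have := hBl v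
    have := hBr v
    simp only [hβ']
    grind
  have hfwd : ∀ x y, x < y → (y ≤ e' x ↔ (y / 2 ≤ e (x / 2) ∨ (x = 1 ∧ y = 2 * (e 0 + 1)))) := by
    intro x y _
    simp only [he']
    split_ifs with hx
    · subst hx
      norm_num
      omega
    · omega
  have hbwd : ∀ x y, x ≤ y → (x + 2 * n ≤ e' y ↔ x / 2 + n ≤ e (y / 2)) := by
    intro x y _
    simp only [he']
    split_ifs with hy
    · subst hy
      norm_num
      omega
    · omega
  refine IsCutRep.isPCA (n := 2 * n) (e := e') (β := β') ⟨?_, ?_, ?_, ?_, ?_, ?_, ?_⟩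
  · intro v
    have := h.lt v
    have := hhalf v
    omega
  · intro x hx
    have := h.le_end (x / 2) (by omega)
    simp only [he']
    split_ifs <;> omega
  · intro x hx
    have := h.end_lt (x / 2) (by omega)
    simp only [he']
    split_ifs <;> omega
  · intro x hx
    simp only [he']
    rcases Nat.even_or_odd' x with ⟨k, rfl | rfl⟩
    · rw [show (2 * k + 1) / 2 = k by omega, show 2 * k / 2 = k by omega]
      split_ifs with h1 h2
      · omega
      · omega
      · rw [show k = 0 by omega]; omega
      · omega
    · rw [show (2 * k + 1 + 1) / 2 = k + 1 by omega, show (2 * k + 1) / 2 = k by omega]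
      have := h.mono k (by omega)
      split_ifs with h1 h2
      · omega
      · rw [show k = 0 by omega, zero_add]; omega
      · omega
      · omega
  · have := h.wrap
    simp only [he']
    rw [if_neg (by omega), if_neg (by omega), show (2 * n - 1) / 2 = n - 1 by omega]
    norm_num
    omega
  · intro x y hxy hy hle
    by_contra! hge
    rw [hbwd x y hxy.le] at hge
    rw [hfwd x y hxy] at hle
    rcases hle with hle | ⟨rfl, rfl⟩
    · rcases (show x / 2 < y / 2 ∨ x / 2 = y / 2 by omega) with hlt | heq
      · have := h.normal _ _ hlt (by omega) hle
        omega
      · have := h.end_lt (y / 2) (by omega)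
        omega
    · rw [show 2 * (e 0 + 1) / 2 = e 0 + 1 by omega] at hge
      omega
  · intro u v huv hle
    have hle' : β u ≤ β v := by
      have := hhalf u
      have := hhalf v
      omega
    have hvu : ¬(v ∈ Bl ∧ u ∈ Br) := by
      rintro ⟨h1, h2⟩
      have := hBl v h1
      have := hBr u h2
      omega
    have hadj : (G ⊔ SimpleGraph.fromRel (fun v w => v ∈ Bl ∧ w ∈ Br)).Adj u v ↔
        (G.Adj u v ∨ (u ∈ Bl ∧ v ∈ Br)) := by
      simp [SimpleGraph.fromRel_adj, huv, hvu]
    rw [hadj, h.adj u v huv hle', hbwd _ _ hle, hhalf, hhalf]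
    rcases hle.eq_or_lt with heq | hlt
    · have hβ : β u = β v := by rw [← hhalf u, ← hhalf v, heq]
      have h1 := h.le_end _ (h.lt v)
      have h2 : β' v ≤ e' (β' v) := by
        have := hhalf v
        simp only [he']
        split_ifs
        · omega
        · rw [hhalf]; omega
      rw [heq, hβ]
      simp [h1, h2]
    · rw [hfwd _ _ hlt, hhalf, hhalf, hl, hr]
      tauto

theorem le_of_connectable {n : ℕ} [NeZero n] {r : ZMod n → ℕ} (hr : IsRoundRep n r) {a b : ZMod n}
    (h : Connectable r a b) : r a ≤ r (a + 1) := by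
  obtain ⟨hlt, hround⟩ := hr
  obtain ⟨hb, ha⟩ := h
  simp only [Ur, Fr, Ul, Fl] at hb ha
  set S : Set (ZMod n) := {j : ZMod n | Arrow r j b} with hS
  by_contra! hcon
  have hstep : ∀ k : ℕ, r a ≤ k → k < n → r (b - (k : ZMod n)) < k := by
    intro k hk
    induction k, hk using Nat.le_induction with
    | base =>
      intro _
      rwa [show b - ((r a : ℕ) : ZMod n) = a + 1 by rw [hb]; ring]
    | succ k _ ih =>
      intro hkn
      have h1 := ih (by omega)
      have h2 := hround (b - ((k + 1 : ℕ) : ZMod n))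
      rw [show b - ((k + 1 : ℕ) : ZMod n) + 1 = b - (k : ZMod n) by push_cast; ring] at h2
      omega
  have hsub : S ⊆
      ((Finset.Ico 1 (r a)).image (fun k : ℕ => b - (k : ZMod n)) : Finset (ZMod n)) := by
    rintro j ⟨k, hk1, hk, hj⟩
    have hj' : j = b - (k : ZMod n) := by rw [hj]; ring
    have := hlt j
    have : k < r a := by
      by_contra! hk'
      have := hstep k hk' (by omega)
      rw [← hj'] at this
      omega
    rw [Finset.mem_coe, Finset.mem_image]
    exact ⟨k, Finset.mem_Ico.2 ⟨hk1, this⟩, hj'.symm⟩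
  have hcard : S.ncard < r a := by
    have h1 := Set.ncard_le_ncard hsub (Finset.finite_toSet _)
    rw [Set.ncard_coe_finset] at h1
    have h2 := Finset.card_image_le (s := Finset.Ico 1 (r a)) (f := fun k : ℕ => b - (k : ZMod n))
    rw [Nat.card_Ico] at h2
    omega
  have heq : ((S.ncard : ℕ) : ZMod n) = ((r a : ℕ) : ZMod n) := by
    rw [hb] at ha
    linear_combination ha
  rw [ZMod.natCast_eq_natCast_iff', Nat.mod_eq_of_lt (hlt a),
    Nat.mod_eq_of_lt (hcard.trans (hlt a))] at heq
  omega

theorem stmt13 {V : Type*} [Fintype V] (G : SimpleGraph V) (n : ℕ) (hn : 1 ≤ n)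
    (r : ZMod n → ℕ) (β : V → ZMod n) (hrep : IsRoundRepOf G n r β)
    (hconn : (roundGraph r).Connected)
    (a b : ZMod n) (hab : a ≠ b) (hcon : Connectable r a b)
    (Bl Br : Set V) (hBl : Bl ⊆ β ⁻¹' {a}) (hBr : Br ⊆ β ⁻¹' {b}) :
    IsPCA (G ⊔ SimpleGraph.fromRel (fun v w => v ∈ Bl ∧ w ∈ Br)) := by
  have : NeZero n := ⟨by omega⟩
  by_cases hba : Arrow r b a
  · have hle : SimpleGraph.fromRel (fun v w => v ∈ Bl ∧ w ∈ Br) ≤ G := by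
      have key : ∀ v w, v ≠ w → v ∈ Bl → w ∈ Br → G.Adj v w := by
        intro v w hvw hv hw
        have h1 : β v = a := hBl hv
        have h2 : β w = b := hBr hw
        rw [hrep.2.2.2 v w hvw, h1, h2]
        exact Or.inr ((SimpleGraph.fromRel_adj _ _ _).2 ⟨hab, Or.inr hba⟩)
      intro v w h
      rw [SimpleGraph.fromRel_adj] at h
      rcases h with ⟨hvw, h | h⟩
      · exact key v w hvw h.1 h.2
      · exact (key w v hvw.symm h.1 h.2).symm
    rw [sup_eq_left.2 hle]
    exact ⟨n, hn, r, β, hrep⟩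
  · have hround := hrep.1
    have hb : b = a + ((r a + 1 : ℕ) : ZMod n) := by
      rw [hcon.1, Ur, Fr]; push_cast; ring
    have hlt : r a + 1 < n := by
      refine lt_of_le_of_ne (hround.1 a) fun h => hab ?_
      rw [hb, h, ZMod.natCast_self, add_zero]
    have hle := le_of_connectable hround hcon
    have : Nonempty V := ⟨(hrep.2.2.1 a).choose⟩
    have hba' := arrow_backward_iff hround.1 a (Nat.succ_pos (r a)) hlt
    rw [Nat.succ_eq_add_one, ← hb, Nat.cast_zero, add_zero] at hba'
    refine (hrep.isCutRep a).isPCA_sup ?_ ?_ ?_ Bl Br ?_ ?_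
    · simpa using hlt
    · simp only [Nat.cast_zero, Nat.cast_one, add_zero]
      omega
    · simp only [Nat.cast_zero, add_zero, zero_add, ← hb]
      rw [hba'] at hba
      omega
    · intro v hv
      have h1 : β v = a := hBl hv
      simp [h1]
    · intro v hv
      have h1 : β v = b := hBr hv
      simp only [Nat.cast_zero, add_zero, zero_add]
      rw [h1, hb, add_sub_cancel_left, ZMod.val_cast_of_lt hlt]
end
end
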